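/- (Main theorem, Theorem 1.1, weak formulation.) Let N > 2 and 2* = 2N/(N−2). Let 0 < R₁ < r₁ < r₂ < R₂ and α > 0, set Ω = {x ∈ ℝᴺ : r₁ < |x| < r₂} and Λ = {x ∈ ℝᴺ : R₁ < |x| < R₂}, and let V : ℝᴺ → ℝ be continuous, radially symmetric, with V ≥ 0, V = 0 on Ω, and V(x) ≥ α for x ∉ Λ. Then there exists ε₀ > 0 such that for every ε ∈ (0, ε₀) there exists a nonnegative, radially symmetric, continuous function v : ℝᴺ → ℝ, not identically zero, possessing a weak gradient ∇v ∈ L²(ℝᴺ; ℝᴺ) with ∫ V(x) f(v)² dx < ∞, satisfying, for every smooth compactly supported φ : ℝᴺ → ℝ, ε · ∫ ∇v·∇φ dx + ∫ V(x) f(v) f'(v) φ dx = ∫ f(v)^{2·2*−1} f'(v) φ dx, and such that the function u = f(v) satisfies u(x) → 0 as |x| → +∞. (The function u = f(v) is then a nonnegative weak solution of −εΔu + V(x)u − ε Δ(u²)·u = u^{2·2*−1} in ℝᴺ.) -/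

import Mathlib

open MeasureTheory Filter

/-- The function `h(u) = (1/2)·u·√(1+u²) + (1/2)·log(u + √(1+u²))`. -/
noncomputable def h (u : ℝ) : ℝ :=
  (1/2) * u * Real.sqrt (1 + u^2) + (1/2) * Real.log (u + Real.sqrt (1 + u^2))

section helpers
open Set
open scoped Topology


/-- inner average -/
noncomputable def kAvg (n : ℕ) (g : ℝ → ℝ) (s : ℝ) : ℝ := ∫ τ in (0:ℝ)..1, τ ^ n * g (s * τ)

lemma kAvg_continuous (n : ℕ) {g : ℝ → ℝ} (hg : Continuous g) : Continuous (kAvg n g) := by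
  unfold kAvg
  apply intervalIntegral.continuous_parametric_intervalIntegral_of_continuous'
  fun_prop

lemma kAvg_sub_le (n : ℕ) {g g' : ℝ → ℝ} (hg : Continuous g) (hg' : Continuous g') (s B : ℝ)
    (hB : ∀ τ ∈ Icc (0:ℝ) 1, |g (s * τ) - g' (s * τ)| ≤ B) :
    |kAvg n g s - kAvg n g' s| ≤ B := by
  unfold kAvg
  rw [← intervalIntegral.integral_sub]
  · have := intervalIntegral.norm_integral_le_of_norm_le_const (a := (0:ℝ)) (b := 1) (C := B)
      (f := fun τ => τ ^ n * g (s * τ) - τ ^ n * g' (s * τ)) ?_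
    · simpa using this
    · intro τ hτ
      rw [uIoc_of_le zero_le_one] at hτ
      have h1 := hB τ ⟨hτ.1.le, hτ.2⟩
      rw [← mul_sub, Real.norm_eq_abs, abs_mul, abs_of_nonneg (pow_nonneg hτ.1.le n)]
      have h2 : τ ^ n ≤ 1 := pow_le_one₀ hτ.1.le hτ.2
      have := abs_nonneg (g (s * τ) - g' (s * τ))
      nlinarith
  · apply Continuous.intervalIntegrable; fun_prop
  · apply Continuous.intervalIntegrable; fun_prop

theorem ode_family (n : ℕ) (G : ℝ → ℝ → ℝ) (hG : Continuous (Function.uncurry G))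
    (l : ℝ → ℝ) (hl : Continuous l) (hlip : ∀ t x y, |G t x - G t y| ≤ l t * |x - y|)
    (h0 : ∀ t, G t 0 = 0) :
    ∃ (v : ℝ → ℝ → ℝ) (E : ℝ → ℝ), (∀ a, Continuous (v a)) ∧ Continuous E ∧
      (∀ a r, 0 ≤ r → v a r = a + ∫ s in (0:ℝ)..r, s * kAvg n (fun t => G t (v a t)) s) ∧
      (∀ a b r, |v a r - v b r| ≤ E r * |a - b|) ∧ (∀ r, v 0 r = 0) := by
  -- running supremum
  obtain ⟨m, hmc, hm0, hm⟩ : ∃ m : ℝ → ℝ, Continuous m ∧ (∀ s, 0 ≤ m s) ∧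
      ∀ s, ∀ τ ∈ Icc (0:ℝ) 1, l (s * τ) ≤ m s := by
    refine ⟨fun s => sSup ((fun τ => |l (s * τ)|) '' Icc 0 1), ?_, ?_, ?_⟩
    · apply IsCompact.continuous_sSup (f := fun s τ => |l (s * τ)|) isCompact_Icc
      change Continuous fun p : ℝ × ℝ => |l (p.1 * p.2)|
      fun_prop
    · intro s
      apply Real.sSup_nonneg
      rintro _ ⟨τ, _, rfl⟩
      exact abs_nonneg _
    · intro s τ hτ
      refine (le_abs_self _).trans (le_csSup ?_ ⟨τ, hτ, rfl⟩)
      exact (isCompact_Icc.image (by fun_prop)).bddAbove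
  set L : ℝ → ℝ := fun r => ∫ s in (0:ℝ)..r, 2 * s * m s with hL
  have hLd : ∀ r, HasDerivAt L (2 * r * m r) r := by
    intro r
    have hc : Continuous fun s => 2 * s * m s := by fun_prop
    exact intervalIntegral.integral_hasDerivAt_right (hc.intervalIntegrable _ _)
      (hc.stronglyMeasurableAtFilter _ _) hc.continuousAt
  have hLc : Continuous L := continuous_iff_continuousAt.2 fun r => (hLd r).continuousAt
  have hLmono : MonotoneOn L (Ici 0) := by
    apply monotoneOn_of_deriv_nonneg (convex_Ici 0) hLc.continuousOn
    · intro x _; exact (hLd x).differentiableAt.differentiableWithinAt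
    · intro x hx
      rw [interior_Ici] at hx
      rw [(hLd x).deriv]
      have := hm0 x
      have : (0:ℝ) < x := hx
      positivity
  have hL0 : L 0 = 0 := by simp [hL]
  have hexpI : ∀ r, ∫ s in (0:ℝ)..r, s * m s * Real.exp (L s) = (Real.exp (L r) - 1) / 2 := by
    intro r
    have : ∀ x ∈ uIcc 0 r, HasDerivAt (fun s => Real.exp (L s) / 2) (x * m x * Real.exp (L x)) x := by
      intro x _
      have h1 : HasDerivAt (fun s => Real.exp (L s)) (Real.exp (L x) * (2 * x * m x)) x :=
        (hLd x).exp
      have h2 := h1.div_const 2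
      have h3 : Real.exp (L x) * (2 * x * m x) / 2 = x * m x * Real.exp (L x) := by ring
      rwa [h3] at h2
    rw [intervalIntegral.integral_eq_sub_of_hasDerivAt this]
    · simp [hL0]; ring
    · apply Continuous.intervalIntegrable; fun_prop
  set T : ℝ → (ℝ → ℝ) → ℝ → ℝ := fun a v r =>
    a + ∫ s in (0:ℝ)..|r|, s * kAvg n (fun t => G t (v t)) s with hT
  have hGv : ∀ v : ℝ → ℝ, Continuous v → Continuous fun t => G t (v t) := by
    intro v hv
    exact hG.comp (continuous_id.prodMk hv)
  have hTc : ∀ a v, Continuous v → Continuous (T a v) := by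
    intro a v hv
    have hk := kAvg_continuous n (hGv v hv)
    have h1 : Continuous fun s => s * kAvg n (fun t => G t (v t)) s := by fun_prop
    have h2 : Continuous fun r => ∫ s in (0:ℝ)..r, s * kAvg n (fun t => G t (v t)) s :=
      intervalIntegral.continuous_primitive (fun a b => h1.intervalIntegrable a b) 0
    exact continuous_const.add (h2.comp continuous_abs)
  have hTd : ∀ a b v w D, Continuous v → Continuous w → 0 ≤ D →
      (∀ r, |v r - w r| ≤ D * Real.exp (L |r|)) →
      ∀ r, |T a v r - T b w r| ≤ (|a - b| + D / 2) * Real.exp (L |r|) := by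
    intro a b v w D hv hw hD hvw r
    have hkv := kAvg_continuous n (hGv v hv)
    have hkw := kAvg_continuous n (hGv w hw)
    have e1 : T a v r - T b w r = (a - b) + ∫ s in (0:ℝ)..|r|,
        (s * kAvg n (fun t => G t (v t)) s - s * kAvg n (fun t => G t (w t)) s) := by
      rw [intervalIntegral.integral_sub]
      · simp only [hT]; ring
      · apply Continuous.intervalIntegrable; fun_prop
      · apply Continuous.intervalIntegrable; fun_prop
    have e2 : |∫ s in (0:ℝ)..|r|,
        (s * kAvg n (fun t => G t (v t)) s - s * kAvg n (fun t => G t (w t)) s)| ≤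
        ∫ s in (0:ℝ)..|r|, D * (s * m s * Real.exp (L s)) := by
      rw [← Real.norm_eq_abs]
      apply intervalIntegral.norm_integral_le_of_norm_le (abs_nonneg r)
      · refine Eventually.of_forall fun s hs => ?_
        rw [← mul_sub, Real.norm_eq_abs, abs_mul, abs_of_nonneg hs.1.le]
        have h3 : |kAvg n (fun t => G t (v t)) s - kAvg n (fun t => G t (w t)) s| ≤
            m s * (D * Real.exp (L s)) := by
          apply kAvg_sub_le n (hGv v hv) (hGv w hw)
          intro τ hτ
          refine (hlip _ _ _).trans ?_
          have hst : 0 ≤ s * τ := mul_nonneg hs.1.le hτ.1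
          have h4 : |v (s * τ) - w (s * τ)| ≤ D * Real.exp (L s) := by
            refine (hvw _).trans ?_
            rw [abs_of_nonneg hst]
            apply mul_le_mul_of_nonneg_left _ hD
            apply Real.exp_le_exp.2
            apply hLmono hst hs.1.le
            have := hs.1; have := hτ.2
            nlinarith
          exact mul_le_mul (hm s τ hτ) h4 (abs_nonneg _) (hm0 s)
        have := mul_le_mul_of_nonneg_left h3 hs.1.le
        linarith
      · apply Continuous.intervalIntegrable; fun_prop
    rw [intervalIntegral.integral_const_mul, hexpI] at e2
    rw [e1]
    refine (abs_add_le _ _).trans ?_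
    have h5 : 1 ≤ Real.exp (L |r|) := by
      apply Real.one_le_exp
      rw [← hL0]; exact hLmono (mem_Ici.2 le_rfl) (abs_nonneg r) (abs_nonneg r)
    have := abs_nonneg (a - b)
    nlinarith
  have hT0 : ∀ r, T 0 (fun _ => 0) r = 0 := by
    intro r
    simp [hT, h0, kAvg]
  -- conjugated operator on bounded continuous functions
  have hbound : ∀ a (w : BoundedContinuousFunction ℝ ℝ), ∀ r,
      ‖Real.exp (-L |r|) * T a (fun t => Real.exp (L |t|) * w t) r‖ ≤ |a| + ‖w‖ / 2 := by
    intro a w r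
    have := hTd a 0 (fun t => Real.exp (L |t|) * w t) (fun _ => 0) ‖w‖ (by fun_prop) (by fun_prop)
      (norm_nonneg w) (by
        intro r
        rw [sub_zero, abs_mul, abs_of_pos (Real.exp_pos _), mul_comm]
        exact mul_le_mul_of_nonneg_right (w.norm_coe_le_norm r) (Real.exp_pos _).le) r
    rw [hT0, sub_zero, sub_zero] at this
    rw [Real.norm_eq_abs, abs_mul, abs_of_pos (Real.exp_pos _)]
    calc _ ≤ Real.exp (-L |r|) * ((|a| + ‖w‖ / 2) * Real.exp (L |r|)) :=
          mul_le_mul_of_nonneg_left this (Real.exp_pos _).le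
      _ = (|a| + ‖w‖ / 2) * (Real.exp (-L |r|) * Real.exp (L |r|)) := by ring
      _ = _ := by rw [← Real.exp_add]; simp
  let Φ : ℝ → BoundedContinuousFunction ℝ ℝ → BoundedContinuousFunction ℝ ℝ := fun a w =>
    BoundedContinuousFunction.ofNormedAddCommGroup
      (fun r => Real.exp (-L |r|) * T a (fun t => Real.exp (L |t|) * w t) r)
      (by
        have := hTc a (fun t => Real.exp (L |t|) * w t) (by fun_prop)
        fun_prop) (|a| + ‖w‖ / 2) (hbound a w)
  have hΦ : ∀ a b w w', dist (Φ a w) (Φ b w') ≤ |a - b| + dist w w' / 2 := by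
    intro a b w w'
    rw [BoundedContinuousFunction.dist_le (by positivity)]
    intro r
    have := hTd a b (fun t => Real.exp (L |t|) * w t) (fun t => Real.exp (L |t|) * w' t) (dist w w')
      (by fun_prop) (by fun_prop) dist_nonneg (by
        intro r
        rw [← mul_sub, abs_mul, abs_of_pos (Real.exp_pos _), mul_comm]
        have h6 : |w r - w' r| ≤ dist w w' :=
          BoundedContinuousFunction.dist_coe_le_dist (f := w) (g := w') r
        exact mul_le_mul_of_nonneg_right h6 (Real.exp_pos _).le) r
    change |Real.exp (-L |r|) * T a (fun t => Real.exp (L |t|) * w t) r -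
      Real.exp (-L |r|) * T b (fun t => Real.exp (L |t|) * w' t) r| ≤ _
    rw [← mul_sub, abs_mul, abs_of_pos (Real.exp_pos _)]
    calc _ ≤ Real.exp (-L |r|) * ((|a - b| + dist w w' / 2) * Real.exp (L |r|)) :=
          mul_le_mul_of_nonneg_left this (Real.exp_pos _).le
      _ = (|a - b| + dist w w' / 2) * (Real.exp (-L |r|) * Real.exp (L |r|)) := by ring
      _ = _ := by rw [← Real.exp_add]; simp
  have hcontr : ∀ a, ContractingWith (1/2) (Φ a) := by
    intro a
    refine ⟨by
      rw [← NNReal.coe_lt_coe]; norm_num, LipschitzWith.of_dist_le_mul fun w w' => ?_⟩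
    have := hΦ a a w w'
    simp at this ⊢
    linarith
  let W : ℝ → BoundedContinuousFunction ℝ ℝ := fun a => (hcontr a).fixedPoint
  have hW : ∀ a, Φ a (W a) = W a := fun a => (hcontr a).fixedPoint_isFixedPt
  refine ⟨fun a r => Real.exp (L |r|) * W a r, fun r => 2 * Real.exp (L |r|), ?_, ?_, ?_, ?_, ?_⟩
  · intro a; fun_prop
  · fun_prop
  · intro a r hr
    have h1 : W a r = Real.exp (-L |r|) * T a (fun t => Real.exp (L |t|) * W a t) r := by
      conv_lhs => rw [← hW a]
      rfl
    have h2 : Real.exp (L |r|) * W a r = T a (fun t => Real.exp (L |t|) * W a t) r := by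
      rw [h1, ← mul_assoc, ← Real.exp_add]; simp
    change Real.exp (L |r|) * W a r = _
    rw [h2]
    simp only [hT, abs_of_nonneg hr]
  · intro a b r
    have h1 : dist (W a) (W b) ≤ 2 * |a - b| := by
      have := hΦ a b (W a) (W b)
      rw [hW, hW] at this
      linarith
    rw [← mul_sub, abs_mul, abs_of_pos (Real.exp_pos _)]
    have h2 : |W a r - W b r| ≤ 2 * |a - b| :=
      (BoundedContinuousFunction.dist_coe_le_dist (f := W a) (g := W b) r).trans h1
    nlinarith [Real.exp_pos (L |r|)]
  · intro r
    have : Φ 0 0 = 0 := by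
      ext r
      change Real.exp (-L |r|) * T 0 (fun t => Real.exp (L |t|) * (0:ℝ)) r = 0
      simp only [mul_zero]
      rw [hT0]; simp
    have h2 : (0 : BoundedContinuousFunction ℝ ℝ) = W 0 := (hcontr 0).fixedPoint_unique this
    change Real.exp (L |r|) * W 0 r = 0
    rw [← h2]; simp
lemma cmp_deriv {f g f' g' : ℝ → ℝ} {a b : ℝ} (hab : a ≤ b)
    (hfc : ContinuousOn f (Icc a b)) (hgc : ContinuousOn g (Icc a b))
    (hf : ∀ x ∈ Ioo a b, HasDerivAt f (f' x) x) (hg : ∀ x ∈ Ioo a b, HasDerivAt g (g' x) x)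
    (hle : ∀ x ∈ Ioo a b, f' x ≤ g' x) : f b - f a ≤ g b - g a := by
  have : MonotoneOn (fun x => g x - f x) (Icc a b) := by
    apply monotoneOn_of_deriv_nonneg (convex_Icc a b) (hgc.sub hfc)
    · intro x hx
      rw [interior_Icc] at hx
      exact ((hg x hx).sub (hf x hx)).differentiableAt.differentiableWithinAt
    · intro x hx
      rw [interior_Icc] at hx
      have h1 : HasDerivAt (g - f) (g' x - f' x) x := (hg x hx).sub (hf x hx)
      rw [h1.deriv]
      linarith [hle x hx]
  have := this (left_mem_Icc.2 hab) (right_mem_Icc.2 hab) hab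
  simp only at this
  linarith

lemma cmp_lower {f f' : ℝ → ℝ} {a b c : ℝ} (hab : a ≤ b)
    (hf : ∀ x ∈ Icc a b, HasDerivAt f (f' x) x)
    (hle : ∀ x ∈ Icc a b, c ≤ f' x) : c * (b - a) ≤ f b - f a := by
  have := cmp_deriv (f := fun x => c * x) (g := f) (f' := fun _ => c) (g' := f') hab
    (by fun_prop) (fun x hx => (hf x hx).continuousAt.continuousWithinAt)
    (fun x _ => by simpa using (hasDerivAt_id x).const_mul c)
    (fun x hx => hf x (Ioo_subset_Icc_self hx)) (fun x hx => hle x (Ioo_subset_Icc_self hx))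
  linarith

lemma cmp_upper {f f' : ℝ → ℝ} {a b c : ℝ} (hab : a ≤ b)
    (hf : ∀ x ∈ Icc a b, HasDerivAt f (f' x) x)
    (hle : ∀ x ∈ Icc a b, f' x ≤ c) : f b - f a ≤ c * (b - a) := by
  have := cmp_lower (f := fun x => - f x) (f' := fun x => - f' x) (c := -c) hab
    (fun x hx => (hf x hx).neg) (fun x hx => by linarith [hle x hx])
  linarith

lemma div_ge_aux {z w w0 Y : ℝ} (hw0 : 0 < w0) (hw : w0 ≤ w) (hY : 0 ≤ Y) (hz : -Y ≤ z) :
    -(Y / w0) ≤ z / w := by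
  have hwp : 0 < w := hw0.trans_le hw
  have h1 : Y / w ≤ Y / w0 := div_le_div_of_nonneg_left hY hw0 hw
  have h2 : (-Y) / w ≤ z / w := div_le_div_of_nonneg_right hz hwp.le
  rw [neg_div] at h2
  linarith

lemma side_bound {w v z G : ℝ → ℝ} {A d B w0 w1 c0 C : ℝ} (hAd : A ≤ d) (hdB : d ≤ B)
    (hw0 : 0 < w0) (hw : ∀ x ∈ Icc A B, w0 ≤ w x ∧ w x ≤ w1)
    (hv' : ∀ x ∈ Icc A B, HasDerivAt v (z x / w x) x)
    (hz' : ∀ x ∈ Icc A B, HasDerivAt z (w x * G x) x)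
    (hv : ∀ x ∈ Icc A B, 0 ≤ v x) (hzA : 0 ≤ z A)
    (hc0 : 0 ≤ c0) (hC : 0 ≤ C)
    (hG1 : ∀ x ∈ Icc A d, -(c0 * v x) ≤ G x) (hG2 : ∀ x ∈ Icc d B, -(C * v x) ≤ G x)
    (hsm : w1 / w0 * (c0 * (B - A) ^ 2 + (c0 * (B - A) + C * (B - d)) * (B - d)) ≤ 1 / 2) :
    ∀ x ∈ Icc A B, (∀ y ∈ Icc A x, v y ≤ 2 * v x) ∧
      -(w1 * (c0 + C) * (B - A) * (2 * v x)) ≤ z x := by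
  intro x hx
  have hAx : A ≤ x := hx.1
  have hsub : ∀ s, s ∈ Icc A x → s ∈ Icc A B := fun s hs => ⟨hs.1, hs.2.trans hx.2⟩
  have hvc : ContinuousOn v (Icc A x) := fun s hs =>
    (hv' s (hsub s hs)).continuousAt.continuousWithinAt
  obtain ⟨y, hy, hymax⟩ := isCompact_Icc.exists_isMaxOn (nonempty_Icc.2 hAx) hvc
  have hP : ∀ s ∈ Icc A x, v s ≤ v y := fun s hs => hymax hs
  have hP0 : 0 ≤ v y := hv y (hsub y hy)
  set P := v y with hPdef
  have hw1 : 0 < w1 := hw0.trans_le ((hw x hx).1.trans (hw x hx).2)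
  have hz1 : ∀ s ∈ Icc A x, s ≤ d → -(w1 * (c0 * (B - A) * P)) ≤ z s := by
    intro s hs hsd
    have := cmp_lower (f := z) (f' := fun x => w x * G x) (c := -(w1 * (c0 * P))) hs.1
      (fun t ht => hz' t (hsub t ⟨ht.1, ht.2.trans hs.2⟩)) (by
        intro t ht
        have ht' : t ∈ Icc A x := ⟨ht.1, ht.2.trans hs.2⟩
        have h1 := hG1 t ⟨ht.1, ht.2.trans hsd⟩
        have h2 := hP t ht'
        have h3 := hw t (hsub t ht')
        have h4 : -(c0 * P) ≤ G t := by nlinarith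
        have h5 : 0 ≤ c0 * P := by positivity
        nlinarith)
    have h6 : s - A ≤ B - A := by linarith [(hsub s hs).2]
    have h7 : w1 * (c0 * P) * (s - A) ≤ w1 * (c0 * P) * (B - A) :=
      mul_le_mul_of_nonneg_left h6 (by positivity)
    linarith
  have hz2 : ∀ s ∈ Icc A x, d ≤ s → -(w1 * ((c0 * (B - A) + C * (B - d)) * P)) ≤ z s := by
    intro s hs hsd
    have := cmp_lower (f := z) (f' := fun x => w x * G x) (c := -(w1 * (C * P))) hsd
      (fun t ht => hz' t (hsub t ⟨hAd.trans ht.1, ht.2.trans hs.2⟩)) (by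
        intro t ht
        have ht' : t ∈ Icc A x := ⟨hAd.trans ht.1, ht.2.trans hs.2⟩
        have h1 := hG2 t ⟨ht.1, (hsub t ht').2⟩
        have h2 := hP t ht'
        have h3 := hw t (hsub t ht')
        have h4 : -(C * P) ≤ G t := by nlinarith
        have h5 : 0 ≤ C * P := by positivity
        nlinarith)
    have h8 := hz1 d ⟨hAd, hsd.trans hs.2⟩ le_rfl
    have h6 : s - d ≤ B - d := by linarith [(hsub s hs).2]
    have h7 : w1 * (C * P) * (s - d) ≤ w1 * (C * P) * (B - d) :=
      mul_le_mul_of_nonneg_left h6 (by positivity)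
    linarith
  have hBA : 0 ≤ B - A := by linarith
  have hBd : 0 ≤ B - d := by linarith
  have hv1 : ∀ s t, A ≤ s → s ≤ t → t ≤ x → t ≤ d →
      -(w1 / w0 * (c0 * (B - A) ^ 2) * P) ≤ v t - v s := by
    intro s t hs hst htx htd
    have := cmp_lower (f := v) (f' := fun x => z x / w x)
      (c := -((w1 * (c0 * (B - A) * P)) / w0)) hst
      (fun u hu => hv' u (hsub u ⟨hs.trans hu.1, hu.2.trans htx⟩)) (by
        intro u hu
        have hu' : u ∈ Icc A x := ⟨hs.trans hu.1, hu.2.trans htx⟩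
        exact div_ge_aux hw0 (hw u (hsub u hu')).1 (by positivity) (hz1 u hu' (hu.2.trans htd)))
    have h7 : (w1 * (c0 * (B - A) * P)) / w0 * (t - s) ≤ (w1 * (c0 * (B - A) * P)) / w0 * (B - A) :=
      mul_le_mul_of_nonneg_left (by linarith [hx.2]) (by positivity)
    have h8 : (w1 * (c0 * (B - A) * P)) / w0 * (B - A) = w1 / w0 * (c0 * (B - A) ^ 2) * P := by
      ring
    linarith
  have hv2 : ∀ s t, d ≤ s → s ≤ t → t ≤ x →
      -(w1 / w0 * ((c0 * (B - A) + C * (B - d)) * (B - d)) * P) ≤ v t - v s := by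
    intro s t hs hst htx
    have := cmp_lower (f := v) (f' := fun x => z x / w x)
      (c := -((w1 * ((c0 * (B - A) + C * (B - d)) * P)) / w0)) hst
      (fun u hu => hv' u (hsub u ⟨hAd.trans (hs.trans hu.1), hu.2.trans htx⟩)) (by
        intro u hu
        have hu' : u ∈ Icc A x := ⟨hAd.trans (hs.trans hu.1), hu.2.trans htx⟩
        exact div_ge_aux hw0 (hw u (hsub u hu')).1 (by positivity) (hz2 u hu' (hs.trans hu.1)))
    have h7 : (w1 * ((c0 * (B - A) + C * (B - d)) * P)) / w0 * (t - s) ≤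
        (w1 * ((c0 * (B - A) + C * (B - d)) * P)) / w0 * (B - d) :=
      mul_le_mul_of_nonneg_left (by linarith [hx.2]) (by positivity)
    have h8 : (w1 * ((c0 * (B - A) + C * (B - d)) * P)) / w0 * (B - d) =
      w1 / w0 * ((c0 * (B - A) + C * (B - d)) * (B - d)) * P := by ring
    linarith
  have key : P ≤ 2 * v x := by
    have e1 : 0 ≤ w1 / w0 * (c0 * (B - A) ^ 2) * P := by positivity
    have e2 : 0 ≤ w1 / w0 * ((c0 * (B - A) + C * (B - d)) * (B - d)) * P := by positivity
    have e3 : w1 / w0 * (c0 * (B - A) ^ 2) * P +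
        w1 / w0 * ((c0 * (B - A) + C * (B - d)) * (B - d)) * P ≤ 1 / 2 * P := by
      have := mul_le_mul_of_nonneg_right hsm hP0
      linarith
    rcases le_total x d with hxd | hxd
    · have := hv1 y x hy.1 hy.2 le_rfl hxd
      linarith
    · rcases le_total y d with hyd | hyd
      · have a1 := hv1 y d hy.1 hyd hxd le_rfl
        have a2 := hv2 d x le_rfl hxd le_rfl
        linarith
      · have a2 := hv2 y x hyd hy.2 le_rfl
        linarith
  refine ⟨fun s hs => (hP s hs).trans key, ?_⟩
  have a1 : w1 * (c0 * (B - A) * P) ≤ w1 * (c0 + C) * (B - A) * P := by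
    have : 0 ≤ w1 * C * (B - A) * P := by positivity
    linarith
  have a2 : w1 * ((c0 * (B - A) + C * (B - d)) * P) ≤ w1 * (c0 + C) * (B - A) * P := by
    have : 0 ≤ w1 * C * (d - A) * P := by
      have : 0 ≤ d - A := by linarith
      positivity
    linarith
  have a3 : w1 * (c0 + C) * (B - A) * P ≤ w1 * (c0 + C) * (B - A) * (2 * v x) :=
    mul_le_mul_of_nonneg_left key (by positivity)
  rcases le_total x d with hxd | hxd
  · have := hz1 x ⟨hAx, le_rfl⟩ hxd
    linarith
  · have := hz2 x ⟨hAx, le_rfl⟩ hxd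
    linarith

lemma barrier_bound {w v z G : ℝ → ℝ} {A b b' B w0 w1 D K : ℝ} (hAb : A ≤ b) (hbb : b ≤ b')
    (hbB : b' ≤ B)
    (hw0 : 0 < w0) (hw : ∀ x ∈ Icc A B, w0 ≤ w x ∧ w x ≤ w1)
    (hv' : ∀ x ∈ Icc A B, HasDerivAt v (z x / w x) x)
    (hz' : ∀ x ∈ Icc A B, HasDerivAt z (w x * G x) x)
    (hv : ∀ x ∈ Icc A B, 0 ≤ v x) (hD : 0 ≤ D) (hK : 0 ≤ K)
    (hG : ∀ x ∈ Icc b b', K * v x ≤ G x)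
    (hside : ∀ x ∈ Icc A B, (∀ y ∈ Icc A x, v y ≤ 2 * v x) ∧ -(D * v x) ≤ z x) :
    v b * (K * w0 / (4 * w1) * (b' - b) ^ 2 - D / w0 * (b' - b)) ≤ v b' := by
  have hsub : ∀ s, s ∈ Icc b b' → s ∈ Icc A B := fun s hs => ⟨hAb.trans hs.1, hs.2.trans hbB⟩
  have hb : b ∈ Icc b b' := ⟨le_rfl, hbb⟩
  have hP0 : 0 ≤ v b := hv b (hsub b hb)
  have hzb := (hside b (hsub b hb)).2
  set P := v b with hP
  have hw1 : 0 < w1 := hw0.trans_le ((hw b (hsub b hb)).1.trans (hw b (hsub b hb)).2)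
  have hz1 : ∀ s ∈ Icc b b', -(D * P) + K * w0 * (P / 2) * (s - b) ≤ z s := by
    intro s hs
    have := cmp_lower (f := z) (f' := fun x => w x * G x) (c := K * w0 * (P / 2)) hs.1
      (fun t ht => hz' t (hsub t ⟨ht.1, ht.2.trans hs.2⟩)) (by
        intro t ht
        have ht' : t ∈ Icc b b' := ⟨ht.1, ht.2.trans hs.2⟩
        have h1 := hG t ht'
        have h2 := (hside t (hsub t ht')).1 b ⟨hAb, ht.1⟩
        have h3 := (hw t (hsub t ht')).1
        have h4 : K * (P / 2) ≤ G t := by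
          have : K * (P / 2) ≤ K * v t := mul_le_mul_of_nonneg_left (by linarith) hK
          linarith
        have h5 : 0 ≤ K * (P / 2) := by positivity
        calc K * w0 * (P / 2) = w0 * (K * (P / 2)) := by ring
          _ ≤ w t * G t := mul_le_mul h3 h4 h5 (hw0.le.trans h3))
    linarith
  have := cmp_deriv (f := fun s => K * w0 / (4 * w1) * P * (s - b) ^ 2 - D * P / w0 * (s - b))
    (g := v) (f' := fun s => K * w0 / (2 * w1) * P * (s - b) - D * P / w0)
    (g' := fun x => z x / w x) hbb
    (by fun_prop) (fun x hx => (hv' x (hsub x hx)).continuousAt.continuousWithinAt)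
    (by
      intro s _
      have h1 := (hasDerivAt_id s).sub_const b
      have h2 := ((h1.pow 2).const_mul (K * w0 / (4 * w1) * P)).sub (h1.const_mul (D * P / w0))
      have h3 : K * w0 / (2 * w1) * P * (s - b) - D * P / w0 =
          K * w0 / (4 * w1) * P * ((2 : ℕ) * (id s - b) ^ (2 - 1) * 1) - D * P / w0 * 1 := by
        simp only [id]
        push_cast
        field_simp
        ring
      rw [h3]
      exact h2)
    (fun x hx => hv' x (hsub x (Ioo_subset_Icc_self hx)))
    (by
      intro s hs
      have hs' := Ioo_subset_Icc_self hs
      have h1 := hz1 s hs'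
      have h3 := hw s (hsub s hs')
      have hwp : 0 < w s := hw0.trans_le h3.1
      have hsb : 0 ≤ s - b := by linarith [hs.1]
      have hU : 0 ≤ K * w0 * (P / 2) * (s - b) := by positivity
      have hY : 0 ≤ D * P := by positivity
      have e1 : (K * w0 * (P / 2) * (s - b)) / w1 ≤ (K * w0 * (P / 2) * (s - b)) / w s :=
        div_le_div_of_nonneg_left hU hwp h3.2
      have e2 : (D * P) / w s ≤ (D * P) / w0 := div_le_div_of_nonneg_left hY hw0 h3.1
      have e3 : (-(D * P) + K * w0 * (P / 2) * (s - b)) / w s ≤ z s / w s :=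
        div_le_div_of_nonneg_right h1 hwp.le
      have e4 : (-(D * P) + K * w0 * (P / 2) * (s - b)) / w s =
        - ((D * P) / w s) + (K * w0 * (P / 2) * (s - b)) / w s := by ring
      have e5 : K * w0 / (2 * w1) * P * (s - b) = (K * w0 * (P / 2) * (s - b)) / w1 := by
        field_simp
      linarith)
  simp only [sub_self] at this
  have e : P * (K * w0 / (4 * w1) * (b' - b) ^ 2 - D / w0 * (b' - b)) =
    K * w0 / (4 * w1) * P * (b' - b) ^ 2 - D * P / w0 * (b' - b) := by ring
  rw [e]
  have : v b' - P ≤ v b' := by linarith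
  linarith

lemma middle_bound {w v z G : ℝ → ℝ} {A B w0 w1 : ℝ} (hAB : A < B)
    (hw0 : 0 < w0) (hw : ∀ x ∈ Icc A B, w0 ≤ w x ∧ w x ≤ w1)
    (hv' : ∀ x ∈ Icc A B, HasDerivAt v (z x / w x) x)
    (hz' : ∀ x ∈ Icc A B, HasDerivAt z (w x * G x) x)
    (hv : ∀ x ∈ Icc A B, 0 ≤ v x) (hG : ∀ x ∈ Icc A B, G x ≤ 0)
    {y : ℝ} (hy : y ∈ Icc A B) (hmax : ∀ x ∈ Icc A B, v x ≤ v y) :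
    (∀ x ∈ Icc (A + (B - A) / 4) (B - (B - A) / 4), w0 / (8 * w1) * v y ≤ v x) ∧
    (∀ g0, (∀ x ∈ Icc (A + (B - A) / 4) (B - (B - A) / 4), G x ≤ -g0) → 0 ≤ g0 →
      g0 * (B - A) ^ 2 ≤ 16 * (w1 / w0) * v y) := by
  have hw1 : 0 < w1 := hw0.trans_le ((hw y hy).1.trans (hw y hy).2)
  have hw01 : w0 ≤ w1 := (hw y hy).1.trans (hw y hy).2
  have hP0 : 0 ≤ v y := hv y hy
  have hwp : ∀ x ∈ Icc A B, 0 < w x := fun x hx => hw0.trans_le (hw x hx).1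
  have hanti : ∀ s t, A ≤ s → s ≤ t → t ≤ B → z t ≤ z s := by
    intro s t hs hst ht
    have := cmp_upper (f := z) (f' := fun x => w x * G x) (c := 0) hst
      (fun u hu => hz' u ⟨hs.trans hu.1, hu.2.trans ht⟩) (by
        intro u hu
        have hu' : u ∈ Icc A B := ⟨hs.trans hu.1, hu.2.trans ht⟩
        have := hwp u hu'; have := hG u hu'
        nlinarith)
    linarith
  set P := v y with hP
  -- slope estimates
  have slopeR : ∀ r ∈ Icc A B, z r ≤ 0 → -z r / w1 * (B - r) ≤ v r := by
    intro r hr hzr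
    have := cmp_upper (f := v) (f' := fun x => z x / w x) (c := z r / w1) hr.2
      (fun u hu => hv' u ⟨hr.1.trans hu.1, hu.2⟩) (by
        intro u hu
        have hu' : u ∈ Icc A B := ⟨hr.1.trans hu.1, hu.2⟩
        have h1 := hanti r u hr.1 hu.1 hu.2
        have h2 := hwp u hu'
        rw [div_le_div_iff₀ h2 hw1]
        have h3 := (hw u hu').2
        nlinarith)
    have h4 := hv B ⟨hAB.le, le_rfl⟩
    have h5 : -z r / w1 * (B - r) = - (z r / w1 * (B - r)) := by ring
    rw [h5]; linarith
  have slopeL : ∀ r ∈ Icc A B, 0 ≤ z r → z r / w1 * (r - A) ≤ v r := by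
    intro r hr hzr
    have := cmp_lower (f := v) (f' := fun x => z x / w x) (c := z r / w1) hr.1
      (fun u hu => hv' u ⟨hu.1, hu.2.trans hr.2⟩) (by
        intro u hu
        have hu' : u ∈ Icc A B := ⟨hu.1, hu.2.trans hr.2⟩
        have h1 := hanti u r hu.1 hu.2 hr.2
        have h2 := hwp u hu'
        rw [div_le_div_iff₀ hw1 h2]
        have h3 := (hw u hu').2
        nlinarith)
    have h4 := hv A ⟨le_rfl, hAB.le⟩
    linarith
  have hJ : ∀ x ∈ Icc (A + (B - A) / 4) (B - (B - A) / 4), x ∈ Icc A B := by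
    intro x hx
    exact ⟨by linarith [hx.1], by linarith [hx.2]⟩
  have arith : ∀ u V : ℝ, 0 ≤ u → 0 ≤ V → u / w1 * ((B - A) / 4) ≤ V → P - u / w0 * (B - A) ≤ V →
      w0 / (8 * w1) * P ≤ V := by
    intro u V hu hV h1 h2
    have e1 : u / w0 * (B - A) = (4 * w1 / w0) * (u / w1 * ((B - A) / 4)) := by
      field_simp
    have e2 : (4 * w1 / w0) * (u / w1 * ((B - A) / 4)) ≤ (4 * w1 / w0) * V :=
      mul_le_mul_of_nonneg_left h1 (by positivity)
    have e3 : V ≤ (w1 / w0) * V := by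
      have : 1 ≤ w1 / w0 := by rw [le_div_iff₀ hw0]; linarith
      nlinarith
    have e4 : 0 ≤ (w1 / w0) * V := by positivity
    have e5 : P ≤ 8 * (w1 / w0) * V := by
      have : (4 * w1 / w0) * V = 4 * ((w1 / w0) * V) := by ring
      linarith
    calc w0 / (8 * w1) * P ≤ w0 / (8 * w1) * (8 * (w1 / w0) * V) :=
          mul_le_mul_of_nonneg_left e5 (by positivity)
      _ = V := by field_simp
  have hA1 : ∀ x ∈ Icc (A + (B - A) / 4) (B - (B - A) / 4), w0 / (8 * w1) * P ≤ v x := by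
    intro x hx
    have hx' := hJ x hx
    rcases le_total y x with hyx | hyx
    · have h1 := cmp_lower (f := v) (f' := fun x => z x / w x) (c := min 0 (z x / w0)) hyx
        (fun u hu => hv' u ⟨hy.1.trans hu.1, hu.2.trans hx'.2⟩) (by
          intro u hu
          have hu' : u ∈ Icc A B := ⟨hy.1.trans hu.1, hu.2.trans hx'.2⟩
          have h1 := hanti u x hu'.1 hu.2 hx'.2
          have h2 := hwp u hu'
          rcases le_total 0 (z u) with h | h
          · exact (min_le_left _ _).trans (div_nonneg h h2.le)
          · refine (min_le_right _ _).trans ?_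
            rw [div_le_div_iff₀ hw0 h2]
            have h3 := (hw u hu').1
            nlinarith)
      rcases le_total (z x) 0 with hz | hz
      · have h2 := slopeR x hx' hz
        apply arith (-z x) (v x) (by linarith) (hv x hx')
        · refine le_trans ?_ h2
          apply mul_le_mul_of_nonneg_left (by linarith [hx.2])
          exact div_nonneg (by linarith) hw1.le
        · have h3 : z x / w0 ≤ 0 := div_nonpos_of_nonpos_of_nonneg hz hw0.le
          rw [min_eq_right h3] at h1
          have h4 : z x / w0 * (B - A) ≤ z x / w0 * (x - y) :=
            mul_le_mul_of_nonpos_left (by linarith [hx'.2, hy.1]) h3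
          have h5 : -z x / w0 * (B - A) = - (z x / w0 * (B - A)) := by ring
          rw [h5]; linarith
      · have h3 : 0 ≤ z x / w0 := div_nonneg hz hw0.le
        rw [min_eq_left h3] at h1
        apply arith 0 (v x) le_rfl (hv x hx')
        · simpa using hv x hx'
        · simp; linarith
    · have h1 := cmp_upper (f := v) (f' := fun x => z x / w x) (c := max 0 (z x / w0)) hyx
        (fun u hu => hv' u ⟨hx'.1.trans hu.1, hu.2.trans hy.2⟩) (by
          intro u hu
          have hu' : u ∈ Icc A B := ⟨hx'.1.trans hu.1, hu.2.trans hy.2⟩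
          have h1 := hanti x u hx'.1 hu.1 hu'.2
          have h2 := hwp u hu'
          rcases le_total 0 (z u) with h | h
          · refine le_trans ?_ (le_max_right _ _)
            rw [div_le_div_iff₀ h2 hw0]
            have h3 := (hw u hu').1
            nlinarith
          · exact (div_nonpos_of_nonpos_of_nonneg h h2.le).trans (le_max_left _ _))
      rcases le_total 0 (z x) with hz | hz
      · have h2 := slopeL x hx' hz
        apply arith (z x) (v x) hz (hv x hx')
        · refine le_trans ?_ h2
          apply mul_le_mul_of_nonneg_left (by linarith [hx.1])
          exact div_nonneg hz hw1.le
        · have h3 : 0 ≤ z x / w0 := div_nonneg hz hw0.le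
          rw [max_eq_right h3] at h1
          have h4 : z x / w0 * (y - x) ≤ z x / w0 * (B - A) :=
            mul_le_mul_of_nonneg_left (by linarith [hx'.1, hy.2]) h3
          linarith
      · have h3 : z x / w0 ≤ 0 := div_nonpos_of_nonpos_of_nonneg hz hw0.le
        rw [max_eq_left h3] at h1
        apply arith 0 (v x) le_rfl (hv x hx')
        · simpa using hv x hx'
        · simp; linarith
  refine ⟨hA1, ?_⟩
  intro g0 hg hg0
  set q1 := A + (B - A) / 4 with hq1
  set q2 := B - (B - A) / 4 with hq2
  have hq : q1 ≤ q2 := by rw [hq1, hq2]; linarith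
  have hq1m := hJ q1 ⟨le_rfl, hq⟩
  have hq2m := hJ q2 ⟨hq, le_rfl⟩
  have hdrop := cmp_upper (f := z) (f' := fun x => w x * G x) (c := -(w0 * g0)) hq
    (fun u hu => hz' u (hJ u hu)) (by
      intro u hu
      have h1 := hg u hu
      have h2 := (hw u (hJ u hu)).1
      nlinarith)
  have hl : 0 < B - A := by linarith
  have hz1 : z q1 * (B - A) ≤ 4 * w1 * P := by
    rcases le_total 0 (z q1) with h | h
    · have h2 := (slopeL q1 hq1m h).trans (hmax q1 hq1m)
      have h3 : z q1 / w1 * (q1 - A) = z q1 * (B - A) / (4 * w1) := by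
        rw [hq1]; field_simp; ring
      rw [h3, div_le_iff₀ (by positivity)] at h2
      linarith
    · have : 0 ≤ 4 * w1 * P := by positivity
      nlinarith
  have hz2 : -z q2 * (B - A) ≤ 4 * w1 * P := by
    rcases le_total (z q2) 0 with h | h
    · have h2 := (slopeR q2 hq2m h).trans (hmax q2 hq2m)
      have h3 : -z q2 / w1 * (B - q2) = -z q2 * (B - A) / (4 * w1) := by
        rw [hq2]; field_simp; ring
      rw [h3, div_le_iff₀ (by positivity)] at h2
      linarith
    · have : 0 ≤ 4 * w1 * P := by positivity
      nlinarith
  have hlen : q2 - q1 = (B - A) / 2 := by rw [hq1, hq2]; ring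
  rw [hlen] at hdrop
  have h6 : w0 * g0 * ((B - A) / 2) * (B - A) ≤ 8 * w1 * P := by
    have h7 : w0 * g0 * ((B - A) / 2) ≤ z q1 - z q2 := by linarith
    have h8 := mul_le_mul_of_nonneg_right h7 hl.le
    linarith
  have h9 : 16 * (w1 / w0) * P = (16 * w1 * P) / w0 := by ring
  rw [h9, le_div_iff₀ hw0]
  linarith


/-- A radial solution, with its flux `z`. -/
structure RadSol (n : ℕ) (G : ℝ → ℝ → ℝ) (a : ℝ) (v z : ℝ → ℝ) : Prop where
  vc : Continuous v
  v0 : v 0 = a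
  z0 : z 0 = 0
  dv : ∀ r, 0 < r → HasDerivAt v (z r / r ^ n) r
  dz : ∀ r, HasDerivAt z (r ^ n * G r (v r)) r
  vint : ∀ r, 0 ≤ r → v r = a + ∫ s in (0:ℝ)..r, s * kAvg n (fun t => G t (v t)) s
  zk : ∀ r, z r = r ^ (n + 1) * kAvg n (fun t => G t (v t)) r

lemma flux_eq (n : ℕ) (g : ℝ → ℝ) (r : ℝ) :
    (∫ t in (0:ℝ)..r, t ^ n * g t) = r ^ (n + 1) * kAvg n g r := by
  have := intervalIntegral.mul_integral_comp_mul_left (a := (0:ℝ)) (b := 1)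
    (f := fun t => t ^ n * g t) r
  simp only [mul_zero, mul_one] at this
  have h2 : (∫ x in (0:ℝ)..1, (r * x) ^ n * g (r * x)) = r ^ n * ∫ x in (0:ℝ)..1, x ^ n * g (r * x) := by
    rw [← intervalIntegral.integral_const_mul]
    apply intervalIntegral.integral_congr
    intro τ _
    change (r * τ) ^ n * g (r * τ) = r ^ n * (τ ^ n * g (r * τ))
    ring
  rw [← this, h2, kAvg]
  ring

lemma radSol_of_int (n : ℕ) (G : ℝ → ℝ → ℝ) (hG : Continuous (Function.uncurry G)) (a : ℝ)
    (v : ℝ → ℝ) (hv : Continuous v)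
    (hvi : ∀ r, 0 ≤ r → v r = a + ∫ s in (0:ℝ)..r, s * kAvg n (fun t => G t (v t)) s) :
    RadSol n G a v (fun r => ∫ t in (0:ℝ)..r, t ^ n * G t (v t)) := by
  have hg : Continuous fun t => G t (v t) := hG.comp (continuous_id.prodMk hv)
  have hk := kAvg_continuous n hg
  refine ⟨hv, by simpa using hvi 0 le_rfl, by simp, ?_, ?_, hvi, fun r => flux_eq n _ r⟩
  · intro r hr
    have hc : Continuous fun s => s * kAvg n (fun t => G t (v t)) s := by fun_prop
    have h1 : HasDerivAt (fun r => ∫ s in (0:ℝ)..r, s * kAvg n (fun t => G t (v t)) s)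
        (r * kAvg n (fun t => G t (v t)) r) r :=
      intervalIntegral.integral_hasDerivAt_right (hc.intervalIntegrable _ _)
        (hc.stronglyMeasurableAtFilter _ _) hc.continuousAt
    have h2 := h1.const_add a
    have h3 : (∫ t in (0:ℝ)..r, t ^ n * G t (v t)) / r ^ n = r * kAvg n (fun t => G t (v t)) r := by
      rw [flux_eq n (fun t => G t (v t)) r]
      field_simp
      ring
    rw [h3]
    refine h2.congr_of_eventuallyEq ?_
    filter_upwards [lt_mem_nhds hr] with s hs
    exact hvi s hs.le
  · intro r
    have hc : Continuous fun t => t ^ n * G t (v t) := by fun_prop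
    exact intervalIntegral.integral_hasDerivAt_right (hc.intervalIntegrable _ _)
        (hc.stronglyMeasurableAtFilter _ _) hc.continuousAt

namespace RadSol
variable {n : ℕ} {G : ℝ → ℝ → ℝ} {a : ℝ} {v z : ℝ → ℝ}

lemma zc (hs : RadSol n G a v z) : Continuous z :=
  continuous_iff_continuousAt.2 fun r => (hs.dz r).continuousAt

/-- flux is monotone where `G ≥ 0` -/
lemma z_mono (hs : RadSol n G a v z) {s t : ℝ} (h0 : 0 ≤ s) (hst : s ≤ t)
    (hG : ∀ u ∈ Icc s t, 0 ≤ G u (v u)) : z s ≤ z t := by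
  have := cmp_lower (f := z) (c := 0) hst (fun u _ => hs.dz u) (by
    intro u hu
    exact mul_nonneg (pow_nonneg (h0.trans hu.1) _) (hG u hu))
  linarith

lemma v_mono (hs : RadSol n G a v z) {s t : ℝ} (h0 : 0 ≤ s) (hst : s ≤ t)
    (hz : ∀ u ∈ Icc s t, 0 ≤ z u) : v s ≤ v t := by
  have := cmp_deriv (f := fun _ => (0:ℝ)) (g := v) (f' := fun _ => 0) (g' := fun u => z u / u ^ n)
    hst continuousOn_const hs.vc.continuousOn (fun u _ => hasDerivAt_const u 0)
    (fun u hu => hs.dv u (h0.trans_lt hu.1))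
    (fun u hu => div_nonneg (hz u (Ioo_subset_Icc_self hu)) (pow_nonneg (h0.trans hu.1.le) _))
  linarith

lemma v_anti (hs : RadSol n G a v z) {s t : ℝ} (h0 : 0 ≤ s) (hst : s ≤ t)
    (hz : ∀ u ∈ Icc s t, z u ≤ 0) : v t ≤ v s := by
  have := cmp_deriv (g := fun _ => (0:ℝ)) (f := v) (g' := fun _ => 0) (f' := fun u => z u / u ^ n)
    hst hs.vc.continuousOn continuousOn_const 
    (fun u hu => hs.dv u (h0.trans_lt hu.1)) (fun u _ => hasDerivAt_const u 0)
    (fun u hu => div_nonpos_of_nonpos_of_nonneg (hz u (Ioo_subset_Icc_self hu))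
      (pow_nonneg (h0.trans hu.1.le) _))
  linarith

/-- the solution cannot return after becoming negative -/
lemma not_return (hs : RadSol n G a v z) (ha : 0 < a) (hG0 : ∀ t x, x ≤ 0 → G t x = 0)
    {r' r : ℝ} (h0 : 0 ≤ r') (hr : r' ≤ r) (hneg : v r' < 0) (hpos : 0 < v r) : False := by
  have hr0 : 0 ≤ r := h0.trans hr
  obtain ⟨ξ, hξ, hmin⟩ := isCompact_Icc.exists_isMinOn (nonempty_Icc.2 hr0) hs.vc.continuousOn
  have hξneg : v ξ < 0 := lt_of_le_of_lt (hmin ⟨h0, hr⟩) hneg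
  have hξ0 : 0 < ξ := by
    rcases hξ.1.eq_or_lt with h | h
    · rw [← h, hs.v0] at hξneg; linarith
    · exact h
  have hξr : ξ < r := by
    rcases hξ.2.eq_or_lt with h | h
    · rw [h] at hξneg; linarith
    · exact h
  have hloc : IsLocalMin v ξ := hmin.isLocalMin (Icc_mem_nhds hξ0 hξr)
  have hzξ : z ξ = 0 := by
    have := hloc.hasDerivAt_eq_zero (hs.dv ξ hξ0)
    rcases div_eq_zero_iff.1 this with h | h
    · exact h
    · exact absurd h (pow_pos hξ0 n).ne'
  set T := Icc ξ r ∩ v ⁻¹' Ici 0 with hT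
  have hTc : IsCompact T := isCompact_Icc.inter_right (isClosed_Ici.preimage hs.vc)
  have hTn : T.Nonempty := ⟨r, ⟨hξr.le, le_rfl⟩, hpos.le⟩
  obtain ⟨t1, ht1, hleast⟩ := hTc.exists_isLeast hTn
  have hle : ∀ u, ξ ≤ u → u < t1 → v u ≤ 0 := by
    intro u h1 h2
    by_contra hcon
    push Not at hcon
    exact absurd (hleast ⟨⟨h1, h2.le.trans ht1.1.2⟩, hcon.le⟩) (not_le.2 h2)
  have hzc : ∀ u ∈ Ico ξ t1, z u ≤ 0 := by
    intro u hu
    have := cmp_upper (f := z) (c := 0) hu.1 (fun x _ => hs.dz x) (by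
      intro x hx
      rw [hG0 x (v x) (hle x hx.1 (hx.2.trans_lt hu.2))]; simp)
    linarith
  have h1 : v t1 ≤ v ξ := by
    have := cmp_deriv (g := fun _ => (0:ℝ)) (f := v) (g' := fun _ => 0) (f' := fun u => z u / u ^ n)
      ht1.1.1 hs.vc.continuousOn continuousOn_const 
      (fun u hu => hs.dv u (hξ0.trans hu.1)) (fun u _ => hasDerivAt_const u 0)
      (fun u hu => div_nonpos_of_nonpos_of_nonneg (hzc u ⟨hu.1.le, hu.2⟩)
        (pow_nonneg (hξ0.le.trans hu.1.le) _))
    linarith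
  have : 0 ≤ v t1 := ht1.2
  linarith

end RadSol

theorem shoot (n : ℕ) (G : ℝ → ℝ → ℝ) (hG : Continuous (Function.uncurry G))
    (l : ℝ → ℝ) (hl : Continuous l) (hlip : ∀ t x y, |G t x - G t y| ≤ l t * |x - y|)
    (hG0 : ∀ t x, x ≤ 0 → G t x = 0) {R₁ R₂ μ Mst : ℝ} (hR₁ : 0 < R₁) (hR₂ : R₁ < R₂) (hμ : 0 < μ)
    (hin : ∀ t, 0 ≤ t → t ≤ R₁ → ∀ x, 0 ≤ x → μ * x ≤ G t x)
    (hout : ∀ t, R₂ ≤ t → ∀ x, 0 ≤ x → μ * x ≤ G t x)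
    (hsmall : ∀ δ > 0, ∃ x₀ > 0, ∀ t ∈ Icc R₁ R₂, ∀ x, 0 ≤ x → x ≤ x₀ → -(δ * x) ≤ G t x)
    (hap : ∀ a v z, 0 < a → RadSol n G a v z → (∀ r, 0 ≤ r → 0 ≤ v r) → v R₁ ≤ Mst) :
    ∃ a v z, 0 < a ∧ RadSol n G a v z ∧ (∀ r, 0 ≤ r → 0 ≤ v r) ∧ (∀ r, R₂ ≤ r → z r ≤ 0) ∧
      Tendsto v atTop (𝓝 0) := by
  obtain ⟨v, E, hvc, hEc, hvi, hE, hv0⟩ := ode_family n G hG l hl hlip (fun t => hG0 t 0 le_rfl)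
  set z : ℝ → ℝ → ℝ := fun a r => ∫ t in (0:ℝ)..r, t ^ n * G t (v a t) with hz
  have hs : ∀ a, RadSol n G a (v a) (z a) := fun a =>
    radSol_of_int n G hG a (v a) (hvc a) (hvi a)
  have hGin : ∀ t, 0 ≤ t → t ≤ R₁ → ∀ x, 0 ≤ G t x := by
    intro t h1 h2 x
    rcases le_total x 0 with h | h
    · rw [hG0 t x h]
    · exact (by positivity : (0:ℝ) ≤ μ * x).trans (hin t h1 h2 x h)
  have hGout : ∀ t, R₂ ≤ t → ∀ x, 0 ≤ G t x := by
    intro t h1 x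
    rcases le_total x 0 with h | h
    · rw [hG0 t x h]
    · exact (by positivity : (0:ℝ) ≤ μ * x).trans (hout t h1 x h)
  -- joint continuity
  have hvj : Continuous (Function.uncurry v) := by
    rw [continuous_iff_continuousAt]
    rintro ⟨a0, t0⟩
    have h1 : Tendsto (fun p : ℝ × ℝ => v a0 p.2) (𝓝 (a0, t0)) (𝓝 (v a0 t0)) :=
      ((hvc a0).comp continuous_snd).continuousAt
    have h2 : Tendsto (fun p : ℝ × ℝ => v p.1 p.2 - v a0 p.2) (𝓝 (a0, t0)) (𝓝 0) := by
      apply squeeze_zero_norm (a := fun p : ℝ × ℝ => E p.2 * |p.1 - a0|)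
      · intro p; exact hE _ _ _
      · have : Continuous fun p : ℝ × ℝ => E p.2 * |p.1 - a0| := by fun_prop
        have := this.tendsto (a0, t0)
        simpa using this
    have h3 := h1.add h2
    simp only [add_zero] at h3
    refine h3.congr ?_
    intro p
    simp [Function.uncurry]
  have hva : ∀ r, Continuous fun a => v a r := fun r =>
    hvj.comp (continuous_id.prodMk continuous_const)
  have hza : ∀ r, Continuous fun a => z a r := by
    intro r
    apply intervalIntegral.continuous_parametric_intervalIntegral_of_continuous'
    have : Continuous fun p : ℝ × ℝ => G p.2 (v p.1 p.2) := hG.comp (continuous_snd.prodMk hvj)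
    exact (continuous_snd.pow n).mul this
  -- the two open sets
  set Z : Set ℝ := {a | ∃ r, 0 ≤ r ∧ v a r < 0} with hZ
  set D : Set ℝ := {a | ∃ r, R₂ ≤ r ∧ 0 < v a r ∧ 0 < z a r} with hD
  have hZo : IsOpen Z := by
    have : Z = ⋃ r ∈ Ici (0:ℝ), {a | v a r < 0} := by
      ext a; simp [hZ]
    rw [this]
    exact isOpen_biUnion fun r _ => isOpen_lt (hva r) continuous_const
  have hDo : IsOpen D := by
    have : D = ⋃ r ∈ Ici R₂, ({a | 0 < v a r} ∩ {a | 0 < z a r}) := by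
      ext a; simp only [hD, mem_ofPred_eq, mem_iUnion, mem_inter_iff, mem_Ici, exists_prop]
    rw [this]
    exact isOpen_biUnion fun r _ =>
      (isOpen_lt continuous_const (hva r)).inter (isOpen_lt continuous_const (hza r))
  have hdisj : ∀ a, 0 < a → a ∈ Z → a ∈ D → False := by
    rintro a ha ⟨r', hr', hneg⟩ ⟨r, hr, hpos, hzpos⟩
    rcases le_total r' r with h | h
    · exact (hs a).not_return ha hG0 hr' h hneg hpos
    · have hr0 : 0 ≤ r := by linarith
      have hzp : ∀ u ∈ Icc r r', 0 ≤ z a u := fun u hu =>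
        hzpos.le.trans ((hs a).z_mono hr0 hu.1 fun t ht => hGout t (hr.trans ht.1) _)
      have := (hs a).v_mono hr0 h hzp
      linarith
  -- inner monotonicity
  have hinner : ∀ a, ∀ r, 0 ≤ r → r ≤ R₁ → a ≤ v a r := by
    intro a r h1 h2
    have hzp : ∀ u ∈ Icc 0 r, 0 ≤ z a u := by
      intro u hu
      have := (hs a).z_mono le_rfl hu.1 fun t ht => hGin t ht.1 (ht.2.trans (hu.2.trans h2)) _
      rw [(hs a).z0] at this
      exact this
    have := (hs a).v_mono le_rfl h1 hzp
    rwa [(hs a).v0] at this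
  -- Z is nonempty
  have hZn : ∃ a, 0 < a ∧ a ∈ Z := by
    by_contra hcon
    push Not at hcon
    have hpos : 0 < |Mst| + 1 := by positivity
    have h1 : ∀ r, 0 ≤ r → 0 ≤ v (|Mst| + 1) r := by
      intro r hr
      by_contra h
      exact hcon _ hpos ⟨r, hr, not_le.1 h⟩
    have h2 := hap _ _ _ hpos (hs _) h1
    have h3 := hinner (|Mst| + 1) R₁ hR₁.le le_rfl
    have := le_abs_self Mst
    linarith
  -- D is nonempty
  have hDn : ∃ a, 0 < a ∧ a ∈ D := by
    obtain ⟨E0, hE0⟩ : ∃ E0, ∀ t ∈ Icc 0 R₂, E t ≤ E0 := by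
      obtain ⟨E0, h⟩ := (isCompact_Icc.image hEc).bddAbove (s := E '' Icc 0 R₂)
      exact ⟨E0, fun t ht => h ⟨t, ht, rfl⟩⟩
    set E1 := |E0| + 1 with hE1
    have hE1p : 0 < E1 := by positivity
    have hvE : ∀ a, 0 < a → ∀ t ∈ Icc 0 R₂, v a t ≤ E1 * a := by
      intro a ha t ht
      have h1 := hE a 0 t
      rw [hv0, sub_zero, sub_zero, abs_of_pos ha] at h1
      have h2 := (le_abs_self (v a t)).trans h1
      have h3 := hE0 t ht
      have h4 := le_abs_self E0
      nlinarith
    set Q := μ * R₁ ^ (n + 1) / (n + 1) with hQ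
    have hQp : 0 < Q := by positivity
    have hR2p : 0 < R₂ := hR₁.trans hR₂
    set δ := Q / (2 * (R₂ ^ n * E1 * R₂)) with hδ
    have hδp : 0 < δ := by positivity
    obtain ⟨x₀, hx₀, hsm⟩ := hsmall δ hδp
    set a := x₀ / E1 with ha
    have hap : 0 < a := by positivity
    have hzR1 : Q * a ≤ z a R₁ := by
      have h1 : ∀ u : ℝ, HasDerivAt (fun r : ℝ => μ * a * (r ^ (n + 1) / (n + 1))) (μ * a * u ^ n) u := by
        intro u
        have h2 := ((hasDerivAt_pow (n + 1) u).div_const ((n : ℝ) + 1)).const_mul (μ * a)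
        have h3 : μ * a * (((n + 1 : ℕ) : ℝ) * u ^ (n + 1 - 1) / ((n : ℝ) + 1)) = μ * a * u ^ n := by
          have : (n : ℝ) + 1 ≠ 0 := by positivity
          rw [Nat.add_sub_cancel]
          push_cast
          field_simp
        rwa [h3] at h2
      have := cmp_deriv (f := fun r : ℝ => μ * a * (r ^ (n + 1) / (n + 1))) (g := z a)
        (f' := fun u => μ * a * u ^ n) (g' := fun r => r ^ n * G r (v a r)) hR₁.le
        (by fun_prop) (hs a).zc.continuousOn (fun u _ => h1 u) (fun u _ => (hs a).dz u) (by
          intro u hu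
          have h2 := hinner a u hu.1.le hu.2.le
          have h3 := hin u hu.1.le hu.2.le _ (hap.le.trans h2)
          have h4 : μ * a ≤ G u (v a u) := (mul_le_mul_of_nonneg_left h2 hμ.le).trans h3
          have h5 : 0 ≤ u ^ n := pow_nonneg hu.1.le n
          nlinarith)
      rw [(hs a).z0] at this
      have e : Q * a = μ * a * (R₁ ^ (n + 1) / (n + 1)) := by rw [hQ]; ring
      simp only [ne_eq, Nat.add_eq_zero_iff, one_ne_zero, and_false, not_false_eq_true, zero_pow,
        zero_div, mul_zero, sub_zero] at this
      rw [e]; exact this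
    have hzp : ∀ r ∈ Icc R₁ R₂, 0 < z a r := by
      intro r hr
      have := cmp_lower (f := z a) (c := -(R₂ ^ n * (δ * (E1 * a)))) hr.1
        (fun u _ => (hs a).dz u) (by
          intro u hu
          have hu0 : 0 ≤ u := hR₁.le.trans hu.1
          have huR : u ≤ R₂ := hu.2.trans hr.2
          have h5 : 0 ≤ u ^ n := pow_nonneg hu0 n
          have h6 : u ^ n ≤ R₂ ^ n := pow_le_pow_left₀ hu0 huR n
          have h7 : -(δ * (E1 * a)) ≤ G u (v a u) := by
            rcases le_total (v a u) 0 with h | h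
            · rw [hG0 u _ h]
              have : 0 ≤ δ * (E1 * a) := by positivity
              linarith
            · have h8 := hvE a hap u ⟨hu0, huR⟩
              have h9 := hsm u ⟨hu.1, huR⟩ (v a u) h (by
                rw [ha] at h8
                rwa [mul_div_cancel₀ _ hE1p.ne'] at h8)
              nlinarith
          have h10 : 0 ≤ δ * (E1 * a) := by positivity
          nlinarith)
      have h11 : R₂ ^ n * (δ * (E1 * a)) * (r - R₁) ≤ R₂ ^ n * (δ * (E1 * a)) * R₂ :=
        mul_le_mul_of_nonneg_left (by linarith [hr.2]) (by positivity)
      have h12 : R₂ ^ n * (δ * (E1 * a)) * R₂ = Q / 2 * a := by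
        rw [hδ]; field_simp
      have : 0 < Q * a := by positivity
      linarith
    refine ⟨a, hap, R₂, le_rfl, ?_, hzp R₂ ⟨hR₂.le, le_rfl⟩⟩
    have h1 := hinner a R₁ hR₁.le le_rfl
    have h2 := (hs a).v_mono hR₁.le hR₂.le fun u hu => (hzp u hu).le
    linarith
  -- connectedness
  obtain ⟨a, ha, haZ, haD⟩ : ∃ a, 0 < a ∧ a ∉ Z ∧ a ∉ D := by
    by_contra hcon
    push Not at hcon
    obtain ⟨a1, h1, h1'⟩ := hZn
    obtain ⟨a2, h2, h2'⟩ := hDn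
    have hsub : Ioi (0:ℝ) ⊆ Z ∪ D := by
      intro a ha
      by_cases h : a ∈ Z
      · exact Or.inl h
      · exact Or.inr (hcon a ha h)
    obtain ⟨a, ha, haZ, haD⟩ := (isPreconnected_Ioi (a := (0:ℝ))) Z D hZo hDo hsub
      ⟨a1, h1, h1'⟩ ⟨a2, h2, h2'⟩
    exact hdisj a ha haZ haD
  have hvn : ∀ r, 0 ≤ r → 0 ≤ v a r := by
    intro r hr
    by_contra h
    exact haZ ⟨r, hr, not_le.1 h⟩
  have hzn : ∀ r, R₂ ≤ r → z a r ≤ 0 := by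
    intro r hr
    have hr0 : 0 < r := by linarith
    by_contra h
    push Not at h
    have h1 : v a r ≤ 0 := by
      by_contra h2
      exact haD ⟨r, hr, not_le.1 h2, h⟩
    have h2 : v a r = 0 := le_antisymm h1 (hvn r hr0.le)
    have hloc : IsLocalMin (v a) r := by
      filter_upwards [lt_mem_nhds hr0] with s hs
      rw [h2]; exact hvn s hs.le
    have := hloc.hasDerivAt_eq_zero ((hs a).dv r hr0)
    rcases div_eq_zero_iff.1 this with h3 | h3
    · linarith
    · exact absurd h3 (pow_pos hr0 n).ne'
  refine ⟨a, v a, z a, ha, hs a, hvn, hzn, ?_⟩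
  have hR2p : 0 < R₂ := hR₁.trans hR₂
  have hanti : ∀ s t, R₂ ≤ s → s ≤ t → v a t ≤ v a s := fun s t h1 h2 =>
    (hs a).v_anti (by linarith) h2 fun u hu => hzn u (h1.trans hu.1)
  have hsmallv : ∀ δ > 0, ∃ r, R₂ ≤ r ∧ v a r < δ := by
    intro δ hδ
    by_contra hcon
    push Not at hcon
    set c := R₂ ^ n * (μ * δ) with hc
    have hcp : 0 < c := by positivity
    set t := R₂ + (|z a R₂| + 1) / c with ht
    have htR : R₂ ≤ t := by
      have : 0 ≤ (|z a R₂| + 1) / c := by positivity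
      linarith
    have := cmp_lower (f := z a) (c := c) htR (fun u _ => (hs a).dz u) (by
      intro u hu
      have h1 := hcon u hu.1
      have h2 := hout u hu.1 _ (hδ.le.trans h1)
      have h3 : μ * δ ≤ G u (v a u) := (mul_le_mul_of_nonneg_left h1 hμ.le).trans h2
      exact mul_le_mul (pow_le_pow_left₀ hR2p.le hu.1 n) h3 (by positivity)
        (pow_nonneg (hR2p.le.trans hu.1) n))
    have h4 : c * (t - R₂) = |z a R₂| + 1 := by
      rw [ht]; field_simp; ring
    have h5 := hzn t htR
    have h6 := neg_abs_le (z a R₂)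
    linarith
  rw [Metric.tendsto_atTop]
  intro δ hδ
  obtain ⟨r, hr, hrδ⟩ := hsmallv δ hδ
  refine ⟨r, fun s hs' => ?_⟩
  have h1 := hanti r s hr hs'
  have h2 := hvn s (by linarith)
  rw [Real.dist_eq, sub_zero, abs_of_nonneg h2]
  linarith


/-- Abstract properties of the two nonlinear factors. -/
structure NL (S A : ℝ → ℝ) (q LA : ℝ) : Prop where
  hq : 0 < q
  Slip : ∀ x y, |S x - S y| ≤ |x - y|
  S0 : ∀ x, x ≤ 0 → S x = 0
  S1 : ∀ x, 0 ≤ x → x / 2 ≤ S x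
  S2 : ∀ x, 0 ≤ x → S x ≤ x
  A0 : ∀ x, 0 ≤ A x
  Am : Monotone A
  Alip : ∀ x y, |A x - A y| ≤ LA * |x - y|
  LA0 : 0 ≤ LA
  Aq : ∀ x, 0 ≤ x → A x ≤ x ^ q
  Aq2 : ∀ x, 0 ≤ x → x ≤ 1 → (x / 2) ^ q ≤ A x
  A2 : ∀ x, 2 ≤ x → A x = A 2

/-- All the constants. -/
structure Cfg (W S A lam : ℝ → ℝ) (n : ℕ) (q LA R₁ ρ₁ ρ₂ R₂ α η b b' β β' c0 C C4 m θ ε : ℝ) :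
    Prop where
  nl : NL S A q LA
  hR1 : 0 < R₁
  hRρ : R₁ ≤ ρ₁ - η
  hη : 0 < η
  hb1 : ρ₁ - η < b
  hb2 : b < b'
  hb3 : b' < ρ₁
  hρ : ρ₁ < ρ₂
  hβ1 : ρ₂ < β
  hβ2 : β < β'
  hβ3 : β' < ρ₂ + η
  hρR : ρ₂ + η ≤ R₂
  Wc : Continuous W
  W0 : ∀ t, 0 ≤ W t
  Wz : ∀ t ∈ Icc ρ₁ ρ₂, W t = 0
  Wm1 : ∀ t ∈ Icc b b', m ≤ W t
  Wm2 : ∀ t ∈ Icc β β', m ≤ W t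
  hα : 0 < α
  Wi : ∀ t, 0 ≤ t → t ≤ R₁ → α ≤ W t
  Wo : ∀ t, R₂ ≤ t → α ≤ W t
  lc : Continuous lam
  l1 : ∀ t, c0 ≤ lam t
  l2 : ∀ t, lam t ≤ C
  lL : ∀ t, t ≤ ρ₁ - η → lam t = c0
  lR : ∀ t, ρ₂ + η ≤ t → lam t = c0
  lM : ∀ t ∈ Icc b β', lam t = C
  hc0 : 0 < c0
  hC : 0 < C
  hsm : R₂ ^ n / R₁ ^ n * (c0 * R₂ ^ 2 + (c0 * R₂ + C * η) * η) ≤ 1 / 2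
  hC4 : 32 * (R₂ ^ n / R₁ ^ n) ≤ C4 * (R₁ ^ n / (8 * R₂ ^ n) * (ρ₂ - ρ₁) ^ 2)
  hC4C : C4 < C
  hC4q : (4 / (R₁ ^ n / (8 * R₂ ^ n))) ^ q * C4 ≤ C
  hθ : 0 < θ
  hθC : θ ^ q * C ≤ c0
  hm : 0 < m
  hε : 0 < ε
  hεα : 2 * C * ε ≤ α
  hεm : 2 * C * ε ≤ m
  hεC : C * ε ≤ 1
  hε4 : C4 * ε < (1 / 2) ^ q
  bar1 : 2 / θ ≤ m / (4 * ε) * R₁ ^ n / (4 * R₂ ^ n) * (b' - b) ^ 2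
    - (R₂ ^ n * (c0 + C) * R₂ * 2) / R₁ ^ n * (b' - b)
  bar2 : 2 / θ ≤ m / (4 * ε) * R₁ ^ n / (4 * R₂ ^ n) * (β' - β) ^ 2
    - (R₂ ^ n * (c0 + C) * R₂ * 2) / R₁ ^ n * (β' - β)

noncomputable def GG (W S A lam : ℝ → ℝ) (ε t x : ℝ) : ℝ :=
  S x * (W t / ε - min (A x / ε) (lam t))

lemma one_side {w v z G : ℝ → ℝ} {A d b b' B w0 w1 c0 C R η K θ : ℝ} (hAd : A ≤ d) (hdb : d < b)
    (hbb : b < b') (hbB : b' < B) (hBA : B - A ≤ R) (hη : B - d = η)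
    (hw0 : 0 < w0) (hw : ∀ x ∈ Icc A B, w0 ≤ w x ∧ w x ≤ w1)
    (hv' : ∀ x ∈ Icc A B, HasDerivAt v (z x / w x) x)
    (hz' : ∀ x ∈ Icc A B, HasDerivAt z (w x * G x) x)
    (hv : ∀ x ∈ Icc A B, 0 ≤ v x) (hzA : 0 ≤ z A)
    (hc0 : 0 < c0) (hC : 0 < C) (hK : 0 ≤ K) (hθ : 0 < θ)
    (hG1 : ∀ x ∈ Icc A d, -(c0 * v x) ≤ G x) (hG2 : ∀ x ∈ Icc d B, -(C * v x) ≤ G x)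
    (hG3 : ∀ x ∈ Icc b b', K * v x ≤ G x)
    (hsm : w1 / w0 * (c0 * R ^ 2 + (c0 * R + C * η) * η) ≤ 1 / 2)
    (hbar : 2 / θ ≤ K * w0 / (4 * w1) * (b' - b) ^ 2 - (w1 * (c0 + C) * R * 2) / w0 * (b' - b)) :
    (∀ y ∈ Icc A B, v y ≤ 2 * v B) ∧ ∀ y ∈ Icc A b, v y ≤ 2 * θ * v B := by
  have hAB : A ≤ B := by linarith
  have hw1 : 0 < w1 := hw0.trans_le ((hw A ⟨le_rfl, hAB⟩).1.trans (hw A ⟨le_rfl, hAB⟩).2)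
  have hη0 : 0 < η := by linarith
  have hR : 0 ≤ B - A := by linarith
  have hsq : (B - A) ^ 2 ≤ R ^ 2 := pow_le_pow_left₀ hR hBA 2
  have hsm' : w1 / w0 * (c0 * (B - A) ^ 2 + (c0 * (B - A) + C * (B - d)) * (B - d)) ≤ 1 / 2 := by
    refine le_trans ?_ hsm
    rw [hη]
    gcongr
  have hs := side_bound hAd (by linarith : d ≤ B) hw0 hw hv' hz' hv hzA hc0.le hC.le hG1 hG2 hsm'
  have hs2 : ∀ x ∈ Icc A B, (∀ y ∈ Icc A x, v y ≤ 2 * v x) ∧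
      -((w1 * (c0 + C) * R * 2) * v x) ≤ z x := by
    intro x hx
    refine ⟨(hs x hx).1, le_trans ?_ (hs x hx).2⟩
    have : w1 * (c0 + C) * (B - A) * (2 * v x) ≤ w1 * (c0 + C) * R * (2 * v x) := by
      have := hv x hx
      gcongr
    linarith
  have hR0 : 0 ≤ R := hR.trans hBA
  have hbr := barrier_bound (by linarith : A ≤ b) hbb.le hbB.le hw0 hw hv' hz' hv
    (by positivity) hK hG3 hs2
  refine ⟨(hs B ⟨hAB, le_rfl⟩).1, fun y hy => ?_⟩
  have hb : b ∈ Icc A B := ⟨by linarith, by linarith⟩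
  have h1 := (hs b hb).1 y hy
  have h2 := (hs B ⟨hAB, le_rfl⟩).1 b' ⟨by linarith, hbB.le⟩
  have h3 : v b * (2 / θ) ≤ 2 * v B :=
    ((mul_le_mul_of_nonneg_left hbar (hv b hb)).trans hbr).trans h2
  have h4 : v b ≤ θ * v B := by
    rw [mul_div_assoc', div_le_iff₀ hθ] at h3
    linarith
  linarith

namespace Cfg
variable {W S A lam : ℝ → ℝ} {n : ℕ} {q LA R₁ ρ₁ ρ₂ R₂ α η b b' β β' c0 C C4 m θ ε : ℝ}

lemma Sn (hc : NL S A q LA) (x : ℝ) : 0 ≤ S x := by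
  rcases le_total x 0 with h | h
  · rw [hc.S0 x h]
  · linarith [hc.S1 x h]

lemma G_lower (hc : Cfg W S A lam n q LA R₁ ρ₁ ρ₂ R₂ α η b b' β β' c0 C C4 m θ ε) (t x : ℝ)
    (hx : 0 ≤ x) : -(lam t * x) ≤ GG W S A lam ε t x := by
  have h1 := hc.nl.S2 x hx
  have h2 := Sn hc.nl x
  have h3 : 0 ≤ W t / ε := div_nonneg (hc.W0 t) hc.hε.le
  have h4 := min_le_right (A x / ε) (lam t)
  have h5 := hc.hc0.le.trans (hc.l1 t)
  unfold GG
  nlinarith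

lemma G_big (hc : Cfg W S A lam n q LA R₁ ρ₁ ρ₂ R₂ α η b b' β β' c0 C C4 m θ ε) {t x y : ℝ}
    (hx : 0 ≤ x) (hy : y ≤ W t) (hCy : 2 * C * ε ≤ y) :
    y / (4 * ε) * x ≤ GG W S A lam ε t x := by
  have hε := hc.hε
  have h1 := hc.nl.S1 x hx
  have h3 : y / ε ≤ W t / ε := by gcongr
  have h4 := (min_le_right (A x / ε) (lam t)).trans (hc.l2 t)
  have h5 : 2 * C ≤ y / ε := by rw [le_div_iff₀ hε]; exact hCy
  have e : y / (4 * ε) = y / ε / 4 := by field_simp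
  have h6 : 0 ≤ y / ε := by linarith [hc.hC]
  rw [e]
  unfold GG
  have h7 : y / ε / 2 ≤ W t / ε - min (A x / ε) (lam t) := by linarith
  calc y / ε / 4 * x = x / 2 * (y / ε / 2) := by ring
    _ ≤ S x * (W t / ε - min (A x / ε) (lam t)) := by
      apply mul_le_mul h1 h7 (by positivity) (Sn hc.nl x)

lemma G_zero (hc : NL S A q LA) (t x : ℝ) (hx : x ≤ 0) :
    GG W S A lam ε t x = 0 := by
  unfold GG
  rw [hc.S0 x hx, zero_mul]

lemma Sc (hc : NL S A q LA) : Continuous S :=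
  (LipschitzWith.of_dist_le_mul (K := 1) fun x y => by simpa [Real.dist_eq] using hc.Slip x y).continuous

lemma Ac (hc : NL S A q LA) : Continuous A :=
  (LipschitzWith.of_dist_le_mul (K := ⟨LA, hc.LA0⟩) fun x y => by
    rw [Real.dist_eq, Real.dist_eq]; exact hc.Alip x y).continuous

lemma G_cont (hc : Cfg W S A lam n q LA R₁ ρ₁ ρ₂ R₂ α η b b' β β' c0 C C4 m θ ε) :
    Continuous (Function.uncurry (GG W S A lam ε)) := by
  have h1 := Sc hc.nl
  have h2 := Ac hc.nl
  have h3 := hc.Wc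
  have h4 := hc.lc
  unfold GG Function.uncurry
  fun_prop

lemma G_lip (hc : Cfg W S A lam n q LA R₁ ρ₁ ρ₂ R₂ α η b b' β β' c0 C C4 m θ ε) (t x y : ℝ) :
    |GG W S A lam ε t x - GG W S A lam ε t y| ≤ (W t / ε + (C + 2 * (LA / ε))) * |x - y| := by
  wlog hxy : x ≤ y generalizing x y
  · rw [abs_sub_comm, abs_sub_comm x y]
    exact this y x (le_of_not_ge hxy)
  have hε := hc.hε
  set B : ℝ → ℝ := fun x => min (A x / ε) (lam t) with hB
  have hBn : ∀ x, 0 ≤ B x := fun x =>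
    le_min (div_nonneg (hc.nl.A0 x) hε.le) (hc.hc0.le.trans (hc.l1 t))
  have hBC : ∀ x, B x ≤ C := fun x => (min_le_right _ _).trans (hc.l2 t)
  have hS := hc.nl.Slip x y
  have hW : 0 ≤ W t / ε := div_nonneg (hc.W0 t) hε.le
  have hB2 : S x * |B x - B y| ≤ 2 * (LA / ε) * |x - y| := by
    have hL : 0 ≤ LA / ε := div_nonneg hc.nl.LA0 hε.le
    rcases le_total x 2 with h | h
    · have h1 : S x ≤ 2 := by
        rcases le_total x 0 with h0 | h0
        · rw [hc.nl.S0 x h0]; norm_num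
        · exact (hc.nl.S2 x h0).trans h
      have h2 : |B x - B y| ≤ LA / ε * |x - y| := by
        have h3 := abs_min_sub_min_le_max (A x / ε) (lam t) (A y / ε) (lam t)
        rw [sub_self, abs_zero, max_eq_left (abs_nonneg _)] at h3
        refine h3.trans ?_
        rw [← sub_div, abs_div, abs_of_pos hε, div_mul_eq_mul_div]
        gcongr
        exact hc.nl.Alip x y
      calc S x * |B x - B y| ≤ 2 * (LA / ε * |x - y|) :=
            mul_le_mul h1 h2 (abs_nonneg _) (by norm_num)
        _ = _ := by ring
    · have : B x = B y := by simp only [hB]; rw [hc.nl.A2 x h, hc.nl.A2 y (h.trans hxy)]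
      rw [this, sub_self, abs_zero, mul_zero]
      positivity
  have e : GG W S A lam ε t x - GG W S A lam ε t y =
      (W t / ε - B y) * (S x - S y) - S x * (B x - B y) := by
    simp only [GG, hB]; ring
  rw [e]
  calc _ ≤ |(W t / ε - B y) * (S x - S y)| + |S x * (B x - B y)| := abs_sub _ _
    _ = |W t / ε - B y| * |S x - S y| + S x * |B x - B y| := by
      rw [abs_mul, abs_mul, abs_of_nonneg (Sn hc.nl x)]
    _ ≤ (W t / ε + C) * |x - y| + 2 * (LA / ε) * |x - y| := by
      have : |W t / ε - B y| ≤ W t / ε + C := by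
        rw [abs_le]; constructor <;> linarith [hBn y, hBC y, hc.hC]
      have h0 : 0 ≤ W t / ε + C := by linarith [hc.hC]
      exact add_le_add (mul_le_mul this hS (abs_nonneg _) h0) hB2
    _ = _ := by ring

lemma z_in (hc : Cfg W S A lam n q LA R₁ ρ₁ ρ₂ R₂ α η b b' β β' c0 C C4 m θ ε)
    {a : ℝ} {v z : ℝ → ℝ} (hs : RadSol n (GG W S A lam ε) a v z) (hv : ∀ r, 0 ≤ r → 0 ≤ v r) :
    ∀ r ∈ Icc 0 R₁, 0 ≤ z r := by
  intro r hr
  have := hs.z_mono le_rfl hr.1 fun u hu => by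
    have hα := hc.hα
    have hε := hc.hε
    exact le_trans (mul_nonneg (by positivity) (hv u hu.1))
      (hc.G_big (hv u hu.1) (hc.Wi u hu.1 (hu.2.trans hr.2)) hc.hεα)
  rwa [hs.z0] at this

lemma left (hc : Cfg W S A lam n q LA R₁ ρ₁ ρ₂ R₂ α η b b' β β' c0 C C4 m θ ε)
    {a : ℝ} {v z : ℝ → ℝ} (hs : RadSol n (GG W S A lam ε) a v z) (hv : ∀ r, 0 ≤ r → 0 ≤ v r) :
    (∀ y ∈ Icc 0 ρ₁, v y ≤ 2 * v ρ₁) ∧ ∀ y ∈ Icc 0 b, v y ≤ 2 * θ * v ρ₁ := by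
  obtain ⟨-, hR1, hRρ, hη, hb1, hb2, hb3, hρ, hβ1, hβ2, hβ3, hρR, -⟩ := id hc
  have hε := hc.hε
  have hm := hc.hm
  have hmain := one_side (w := fun r => r ^ n) (v := v) (z := z)
    (G := fun r => GG W S A lam ε r (v r)) (w0 := R₁ ^ n) (w1 := R₂ ^ n)
    (R := R₂) (η := η) (K := m / (4 * ε)) (θ := θ) (c0 := c0) (C := C) hRρ hb1 hb2 hb3 (by linarith)
    (by ring) (pow_pos hR1 n)
    (fun x hx => ⟨pow_le_pow_left₀ hR1.le hx.1 n, pow_le_pow_left₀ (hR1.le.trans hx.1)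
      (by linarith [hx.2]) n⟩)
    (fun x hx => hs.dv x (hR1.trans_le hx.1)) (fun x _ => hs.dz x)
    (fun x hx => hv x (hR1.le.trans hx.1)) (hc.z_in hs hv R₁ ⟨hR1.le, le_rfl⟩) hc.hc0 hc.hC
    (by positivity) hc.hθ
    (fun x hx => by
      have := hc.G_lower x (v x) (hv x (hR1.le.trans hx.1))
      rwa [hc.lL x hx.2] at this)
    (fun x hx => by
      have h0 := hv x (by linarith [hx.1])
      have := hc.G_lower x (v x) h0
      have h2 := mul_le_mul_of_nonneg_right (hc.l2 x) h0
      linarith)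
    (fun x hx => hc.G_big (hv x (by linarith [hx.1])) (hc.Wm1 x hx) hc.hεm)
    hc.hsm hc.bar1
  have hin : ∀ y ∈ Icc 0 R₁, v y ≤ v R₁ := fun y hy =>
    hs.v_mono hy.1 hy.2 fun u hu => hc.z_in hs hv u ⟨hy.1.trans hu.1, hu.2⟩
  constructor
  · intro y hy
    rcases le_total y R₁ with h | h
    · exact (hin y ⟨hy.1, h⟩).trans (hmain.1 R₁ ⟨le_rfl, by linarith⟩)
    · exact hmain.1 y ⟨h, hy.2⟩
  · intro y hy
    rcases le_total y R₁ with h | h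
    · exact (hin y ⟨hy.1, h⟩).trans (hmain.2 R₁ ⟨le_rfl, by linarith⟩)
    · exact hmain.2 y ⟨h, hy.2⟩

lemma right (hc : Cfg W S A lam n q LA R₁ ρ₁ ρ₂ R₂ α η b b' β β' c0 C C4 m θ ε)
    {a : ℝ} {v z : ℝ → ℝ} (hs : RadSol n (GG W S A lam ε) a v z) (hv : ∀ r, 0 ≤ r → 0 ≤ v r)
    (hz : ∀ r, R₂ ≤ r → z r ≤ 0) :
    (∀ y, ρ₂ ≤ y → v y ≤ 2 * v ρ₂) ∧ ∀ y, β' ≤ y → v y ≤ 2 * θ * v ρ₂ := by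
  obtain ⟨-, hR1, hRρ, hη, hb1, hb2, hb3, hρ, hβ1, hβ2, hβ3, hρR, -⟩ := id hc
  have hε := hc.hε
  have hm := hc.hm
  have hmain := one_side (w := fun r => (-r) ^ n) (v := fun r => v (-r)) (z := fun r => -z (-r))
    (G := fun r => GG W S A lam ε (-r) (v (-r))) (w0 := R₁ ^ n) (w1 := R₂ ^ n)
    (A := -R₂) (d := -(ρ₂ + η)) (b := -β') (b' := -β) (B := -ρ₂)
    (R := R₂) (η := η) (K := m / (4 * ε)) (θ := θ) (c0 := c0) (C := C) (by linarith) (by linarith)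
    (by linarith) (by linarith) (by linarith)
    (by ring) (pow_pos hR1 n)
    (fun x hx => ⟨pow_le_pow_left₀ hR1.le (by linarith [hx.2]) n, pow_le_pow_left₀ (by linarith [hx.2])
      (by linarith [hx.1]) n⟩)
    (fun x hx => by
      have h1 := (hs.dv (-x) (by linarith [hx.2])).comp x (hasDerivAt_neg x)
      have e : z (-x) / (-x) ^ n * -1 = -z (-x) / (-x) ^ n := by ring
      rw [e] at h1
      exact h1)
    (fun x _ => by
      have h1 := ((hs.dz (-x)).comp x (hasDerivAt_neg x)).neg
      have e : -((-x) ^ n * GG W S A lam ε (-x) (v (-x)) * -1) =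
        (-x) ^ n * GG W S A lam ε (-x) (v (-x)) := by ring
      rw [e] at h1
      exact h1)
    (fun x hx => hv (-x) (by linarith [hx.2])) (by
      rw [neg_neg]; linarith [hz R₂ le_rfl]) hc.hc0 hc.hC
    (by positivity) hc.hθ
    (fun x hx => by
      have := hc.G_lower (-x) (v (-x)) (hv (-x) (by linarith [hx.2]))
      rwa [hc.lR (-x) (by linarith [hx.2])] at this)
    (fun x hx => by
      have h0 := hv (-x) (by linarith [hx.2])
      have := hc.G_lower (-x) (v (-x)) h0
      have h2 := mul_le_mul_of_nonneg_right (hc.l2 (-x)) h0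
      linarith)
    (fun x hx => hc.G_big (hv (-x) (by linarith [hx.2]))
      (hc.Wm2 (-x) ⟨by linarith [hx.2], by linarith [hx.1]⟩) hc.hεm)
    hc.hsm (by
      have := hc.bar2
      have e : -β - -β' = β' - β := by ring
      rw [e]; exact this)
  have hout : ∀ y, R₂ ≤ y → v y ≤ v R₂ := fun y hy =>
    hs.v_anti (by linarith) hy fun u hu => hz u hu.1
  have m1 : ∀ y ∈ Icc ρ₂ R₂, v y ≤ 2 * v ρ₂ := fun y hy => by
    have := hmain.1 (-y) ⟨by linarith [hy.2], by linarith [hy.1]⟩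
    simpa using this
  have m2 : ∀ y ∈ Icc β' R₂, v y ≤ 2 * θ * v ρ₂ := fun y hy => by
    have := hmain.2 (-y) ⟨by linarith [hy.2], by linarith [hy.1]⟩
    simpa using this
  constructor
  · intro y hy
    rcases le_total y R₂ with h | h
    · exact m1 y ⟨hy, h⟩
    · exact (hout y h).trans (m1 R₂ ⟨by linarith, le_rfl⟩)
  · intro y hy
    rcases le_total y R₂ with h | h
    · exact m2 y ⟨hy, h⟩
    · exact (hout y h).trans (m2 R₂ ⟨by linarith, le_rfl⟩)

lemma middle (hc : Cfg W S A lam n q LA R₁ ρ₁ ρ₂ R₂ α η b b' β β' c0 C C4 m θ ε)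
    {a : ℝ} {v z : ℝ → ℝ} (hs : RadSol n (GG W S A lam ε) a v z) (hv : ∀ r, 0 ≤ r → 0 ≤ v r) :
    ∃ M, 0 ≤ M ∧ (∀ y ∈ Icc ρ₁ ρ₂, v y ≤ M) ∧ (2 * M) ^ q ≤ C * ε := by
  obtain ⟨-, hR1, hRρ, hη, hb1, hb2, hb3, hρ, hβ1, hβ2, hβ3, hρR, -⟩ := id hc
  have hε := hc.hε
  have hq := hc.nl.hq
  have hR2 : 0 < R₂ := by linarith
  obtain ⟨y, hy, hmax⟩ := isCompact_Icc.exists_isMaxOn (nonempty_Icc.2 hρ.le) hs.vc.continuousOn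
  have hM0 : 0 ≤ v y := hv y (by linarith [hy.1])
  have hGv : ∀ x ∈ Icc ρ₁ ρ₂, GG W S A lam ε x (v x) = -(S (v x) * min (A (v x) / ε) C) := by
    intro x hx
    rw [GG, hc.Wz x hx, hc.lM x ⟨by linarith [hx.1], by linarith [hx.2]⟩]; ring
  have hmin0 : ∀ x, 0 ≤ min (A x / ε) C := fun x => le_min (div_nonneg (hc.nl.A0 x) hε.le) hc.hC.le
  obtain ⟨h1, h2⟩ := middle_bound (w := fun r => r ^ n) (v := v) (z := z)
    (G := fun r => GG W S A lam ε r (v r)) (w0 := R₁ ^ n) (w1 := R₂ ^ n) hρ (pow_pos hR1 n)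
    (fun x hx => ⟨pow_le_pow_left₀ hR1.le (by linarith [hx.1]) n, pow_le_pow_left₀ (by linarith [hx.1])
      (by linarith [hx.2]) n⟩)
    (fun x hx => hs.dv x (by linarith [hx.1])) (fun x _ => hs.dz x)
    (fun x hx => hv x (by linarith [hx.1]))
    (fun x hx => by
      rw [hGv x hx]
      have := mul_nonneg (Sn hc.nl (v x)) (hmin0 (v x))
      linarith) hy (fun x hx => hmax hx)
  have hC4 := hc.hC4
  have hC4q := hc.hC4q
  set M := v y with hM
  set c := R₁ ^ n / (8 * R₂ ^ n) with hcd
  set κ := R₂ ^ n / R₁ ^ n with hκ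
  have hcp : 0 < c := by positivity
  have hκp : 0 < κ := by positivity
  have hℓ : 0 < (ρ₂ - ρ₁) ^ 2 := by
    have : 0 < ρ₂ - ρ₁ := by linarith
    positivity
  have hC4p : 0 < C4 := by
    by_contra hcon
    push Not at hcon
    have : C4 * (c * (ρ₂ - ρ₁) ^ 2) ≤ 0 := mul_nonpos_of_nonpos_of_nonneg hcon (by positivity)
    linarith
  have hcM : 0 ≤ c * M := mul_nonneg hcp.le hM0
  refine ⟨M, hM0, fun x hx => hmax hx, ?_⟩
  have hA : A (c * M) ≤ C4 * ε := by
    rcases hM0.eq_or_lt with h0 | hMp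
    · rw [← h0, mul_zero]
      refine (hc.nl.Aq 0 le_rfl).trans ?_
      rw [Real.zero_rpow hq.ne']
      positivity
    · have h3 := h2 (c * M / 2 * min (A (c * M) / ε) C) (by
        intro x hx
        have hx' : x ∈ Icc ρ₁ ρ₂ := ⟨by linarith [hx.1], by linarith [hx.2]⟩
        rw [hGv x hx']
        have h4 := h1 x hx
        have h5 := hc.nl.S1 (v x) (hv x (by linarith [hx'.1]))
        have h6 : min (A (c * M) / ε) C ≤ min (A (v x) / ε) C := by
          have := hc.nl.Am h4
          gcongr
        have h7 : c * M / 2 * min (A (c * M) / ε) C ≤ S (v x) * min (A (v x) / ε) C :=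
          mul_le_mul (by linarith) h6 (hmin0 _) (Sn hc.nl _)
        linarith) (mul_nonneg (by positivity) (hmin0 _))
      have h8 : min (A (c * M) / ε) C ≤ C4 := by
        have h9 : M * (min (A (c * M) / ε) C * (c * (ρ₂ - ρ₁) ^ 2)) ≤ M * (C4 * (c * (ρ₂ - ρ₁) ^ 2)) := by
          have h10 : M * (32 * κ) ≤ M * (C4 * (c * (ρ₂ - ρ₁) ^ 2)) :=
            mul_le_mul_of_nonneg_left hC4 hM0
          nlinarith
        exact le_of_mul_le_mul_right (le_of_mul_le_mul_left h9 hMp) (by positivity)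
      rcases min_le_iff.1 h8 with h | h
      · rwa [div_le_iff₀ hε] at h
      · exact absurd h (not_le.2 hc.hC4C)
  have hlt : c * M < 1 := by
    by_contra hcon
    push Not at hcon
    have h3 := hc.nl.Am hcon
    have h4 := hc.nl.Aq2 1 zero_le_one le_rfl
    have := hc.hε4
    linarith
  have h5 := hc.nl.Aq2 (c * M) hcM hlt.le
  have e : 2 * M = 4 / c * (c * M / 2) := by field_simp; ring
  rw [e, Real.mul_rpow (by positivity) (by positivity)]
  calc (4 / c) ^ q * (c * M / 2) ^ q ≤ (4 / c) ^ q * (C4 * ε) := by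
        gcongr
        exact h5.trans hA
    _ = (4 / c) ^ q * C4 * ε := by ring
    _ ≤ C * ε := by gcongr

end Cfg


namespace Cfg
variable {W S A lam : ℝ → ℝ} {n : ℕ} {q LA R₁ ρ₁ ρ₂ R₂ α η b b' β β' c0 C C4 m θ ε : ℝ}

lemma exists_sol (hc : Cfg W S A lam n q LA R₁ ρ₁ ρ₂ R₂ α η b b' β β' c0 C C4 m θ ε) :
    ∃ a v z, 0 < a ∧ RadSol n (GG W S A lam ε) a v z ∧ (∀ r, 0 ≤ r → 0 ≤ v r) ∧
      (∀ r, R₂ ≤ r → z r ≤ 0) ∧ Tendsto v atTop (𝓝 0) ∧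
      ∀ t, 0 ≤ t → v t ≤ 1 ∧ GG W S A lam ε t (v t) = S (v t) * (W t - A (v t)) / ε := by
  obtain ⟨-, hR1, hRρ, hη, hb1, hb2, hb3, hρ, hβ1, hβ2, hβ3, hρR, -⟩ := id hc
  have hε := hc.hε
  have hq := hc.nl.hq
  have hα := hc.hα
  have hM1 : ∀ M, 0 ≤ M → (2 * M) ^ q ≤ C * ε → 2 * M ≤ 1 := by
    intro M h0 h1
    by_contra hcon
    push Not at hcon
    have := Real.one_lt_rpow hcon hq
    linarith [hc.hεC]
  obtain ⟨a, v, z, ha, hs, hv, hz, hlim⟩ := shoot n (GG W S A lam ε) hc.G_cont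
    (fun t => W t / ε + (C + 2 * (LA / ε))) (by have := hc.Wc; fun_prop) hc.G_lip
    (G_zero hc.nl) (R₁ := R₁) (R₂ := R₂) (μ := α / (4 * ε)) (Mst := 1) hR1 (by linarith)
    (by positivity)
    (fun t h1 h2 x hx => hc.G_big hx (hc.Wi t h1 h2) hc.hεα)
    (fun t h1 x hx => hc.G_big hx (hc.Wo t h1) hc.hεα)
    (by
      intro δ hδ
      refine ⟨(δ * ε) ^ (1 / q), by positivity, fun t _ x hx0 hx1 => ?_⟩
      have h1 : x ^ q ≤ δ * ε := by
        calc x ^ q ≤ ((δ * ε) ^ (1 / q)) ^ q := by gcongr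
          _ = δ * ε := by
            rw [← Real.rpow_mul (by positivity), one_div, inv_mul_cancel₀ hq.ne', Real.rpow_one]
      have h2 : A x / ε ≤ δ := by
        rw [div_le_iff₀ hε]
        exact (hc.nl.Aq x hx0).trans h1
      have h3 := hc.nl.S2 x hx0
      have h4 := Sn hc.nl x
      have h5 : 0 ≤ W t / ε := div_nonneg (hc.W0 t) hε.le
      have h6 := min_le_left (A x / ε) (lam t)
      unfold GG
      nlinarith)
    (by
      intro a v z ha hs hv
      obtain ⟨M, hM0, hM, hMq⟩ := hc.middle hs hv
      have h1 := (hc.left hs hv).1 R₁ ⟨hR1.le, by linarith⟩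
      have h2 := hM ρ₁ ⟨le_rfl, hρ.le⟩
      linarith [hM1 M hM0 hMq])
  refine ⟨a, v, z, ha, hs, hv, hz, hlim, ?_⟩
  obtain ⟨M, hM0, hM, hMq⟩ := hc.middle hs hv
  have hl := hc.left hs hv
  have hr := hc.right hs hv hz
  have hMρ1 := hM ρ₁ ⟨le_rfl, hρ.le⟩
  have hMρ2 := hM ρ₂ ⟨hρ.le, le_rfl⟩
  have hM2 : ∀ t, 0 ≤ t → v t ≤ 2 * M := by
    intro t ht
    rcases le_total t ρ₁ with h | h
    · linarith [hl.1 t ⟨ht, h⟩]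
    · rcases le_total t ρ₂ with h' | h'
      · linarith [hM t ⟨h, h'⟩]
      · linarith [hr.1 t h']
  have hθ := hc.hθ
  have hkey : ∀ t, 0 ≤ t → v t ≤ 2 * θ * M → A (v t) ≤ c0 * ε := by
    intro t ht h
    calc A (v t) ≤ (v t) ^ q := hc.nl.Aq _ (hv t ht)
      _ ≤ (θ * (2 * M)) ^ q := by
        apply Real.rpow_le_rpow (hv t ht) (by linarith) hq.le
      _ = θ ^ q * (2 * M) ^ q := Real.mul_rpow hθ.le (by linarith)
      _ ≤ θ ^ q * (C * ε) := by gcongr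
      _ = (θ ^ q * C) * ε := by ring
      _ ≤ c0 * ε := by gcongr
  have hAl : ∀ t, 0 ≤ t → A (v t) ≤ lam t * ε := by
    intro t ht
    have hcl : c0 * ε ≤ lam t * ε := mul_le_mul_of_nonneg_right (hc.l1 t) hε.le
    rcases le_total t b with h | h
    · refine (hkey t ht ((hl.2 t ⟨ht, h⟩).trans ?_)).trans hcl
      gcongr
    · rcases le_total t β' with h' | h'
      · rw [hc.lM t ⟨h, h'⟩]
        calc A (v t) ≤ (v t) ^ q := hc.nl.Aq _ (hv t ht)
          _ ≤ (2 * M) ^ q := Real.rpow_le_rpow (hv t ht) (hM2 t ht) hq.le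
          _ ≤ C * ε := hMq
      · refine (hkey t ht ((hr.2 t h').trans ?_)).trans hcl
        gcongr
  intro t ht
  refine ⟨(hM2 t ht).trans (hM1 M hM0 hMq), ?_⟩
  rw [GG, min_eq_left ((div_le_iff₀ hε).2 (hAl t ht))]
  ring

lemma integrable_sol (hc : Cfg W S A lam n q LA R₁ ρ₁ ρ₂ R₂ α η b b' β β' c0 C C4 m θ ε)
    {a : ℝ} {v z : ℝ → ℝ} (hs : RadSol n (GG W S A lam ε) a v z) (hv : ∀ r, 0 ≤ r → 0 ≤ v r)
    (hz : ∀ r, R₂ ≤ r → z r ≤ 0) :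
    IntegrableOn (fun r => r ^ n * (r * kAvg n (fun t => GG W S A lam ε t (v t)) r) ^ 2) (Ioi 0) ∧
    IntegrableOn (fun r => r ^ n * (W r * v r ^ 2)) (Ioi 0) := by
  have hR2 : 0 < R₂ := by linarith [hc.hR1, hc.hRρ, hc.hρ, hc.hρR, hc.hη]
  have hε := hc.hε
  have hvc := hs.vc
  have hg : Continuous fun t => GG W S A lam ε t (v t) := hc.G_cont.comp (continuous_id.prodMk hvc)
  have hk := kAvg_continuous n hg
  have hWc := hc.Wc
  set k := kAvg n (fun t => GG W S A lam ε t (v t)) with hkd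
  set g := fun t => GG W S A lam ε t (v t) with hgd
  set D : ℝ → ℝ := fun r => r ^ n * (r * k r) ^ 2 + r ^ n * (g r * v r) with hD
  have hDc : Continuous D := by fun_prop
  have hGb : ∀ r, R₂ ≤ r → W r / (4 * ε) * v r ≤ g r := fun r hr =>
    hc.G_big (hv r (by linarith)) le_rfl (hc.hεα.trans (hc.Wo r hr))
  have hGb2 : ∀ r, R₂ ≤ r → W r / (4 * ε) * v r ^ 2 ≤ g r * v r := fun r hr => by
    have := mul_le_mul_of_nonneg_right (hGb r hr) (hv r (by linarith))
    linarith
  have hWn : ∀ r, 0 ≤ W r / (4 * ε) * v r ^ 2 := fun r =>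
    mul_nonneg (div_nonneg (hc.W0 r) (by positivity)) (sq_nonneg _)
  have hpn : ∀ r, R₂ ≤ r → 0 ≤ r ^ n := fun r hr => pow_nonneg (by linarith) n
  have hD0 : ∀ r, R₂ ≤ r → 0 ≤ D r := fun r hr => by
    have h1 := mul_nonneg (hpn r hr) (sq_nonneg (r * k r))
    have h2 := mul_nonneg (hpn r hr) ((hWn r).trans (hGb2 r hr))
    simp only [hD]; linarith
  have hder : ∀ r, 0 < r → HasDerivAt (fun r => z r * v r) (D r) r := by
    intro r hr
    have h1 := (hs.dz r).mul (hs.dv r hr)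
    have e : r ^ n * GG W S A lam ε r (v r) * v r + z r * (z r / r ^ n) = D r := by
      rw [hs.zk r, ← hkd]
      simp only [hD, hgd]
      field_simp
      ring
    rw [e] at h1
    exact h1
  have hDi : IntegrableOn D (Ioi R₂) := by
    refine integrableOn_Ioi_of_intervalIntegral_norm_bounded (ι := ℝ) (l := atTop) (b := id)
      (-(z R₂ * v R₂)) R₂ (fun i => (hDc.integrableOn_Icc).mono_set Ioc_subset_Icc_self) tendsto_id ?_
    filter_upwards [eventually_ge_atTop R₂] with t ht
    have e1 : (∫ x in R₂..id t, ‖D x‖) = ∫ x in R₂..t, D x := by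
      apply intervalIntegral.integral_congr
      intro x hx
      rw [id, uIcc_of_le ht] at hx
      exact Real.norm_of_nonneg (hD0 x hx.1)
    rw [e1, intervalIntegral.integral_eq_sub_of_hasDerivAt (f := fun r => z r * v r)
      (fun x hx => hder x (by rw [uIcc_of_le ht] at hx; linarith [hx.1]))
      (hDc.intervalIntegrable _ _)]
    have := mul_nonpos_of_nonpos_of_nonneg (hz t ht) (hv t (by linarith))
    linarith
  have hcomb : ∀ F : ℝ → ℝ, Continuous F → ∀ c : ℝ, (∀ r, R₂ ≤ r → ‖F r‖ ≤ c * D r) →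
      IntegrableOn F (Ioi 0) := by
    intro F hF c hb
    rw [← Ioc_union_Ioi_eq_Ioi hR2.le]
    refine IntegrableOn.union (hF.integrableOn_Icc.mono_set Ioc_subset_Icc_self) ?_
    refine Integrable.mono' (g := fun r => c * D r) (hDi.const_mul c) hF.aestronglyMeasurable ?_
    filter_upwards [ae_restrict_mem measurableSet_Ioi] with r hr
    exact hb r (le_of_lt hr)
  constructor
  · refine hcomb _ (by fun_prop) 1 fun r hr => ?_
    have h1 := mul_nonneg (hpn r hr) (sq_nonneg (r * k r))
    have h2 := mul_nonneg (hpn r hr) ((hWn r).trans (hGb2 r hr))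
    rw [Real.norm_of_nonneg h1]
    simp only [hD]; linarith
  · refine hcomb _ (by fun_prop) (4 * ε) fun r hr => ?_
    have h1 := mul_nonneg (hpn r hr) (sq_nonneg (r * k r))
    have h2 := mul_le_mul_of_nonneg_left (hGb2 r hr) (hpn r hr)
    rw [Real.norm_of_nonneg (mul_nonneg (hpn r hr) (mul_nonneg (hc.W0 r) (sq_nonneg _)))]
    have e : r ^ n * (W r * v r ^ 2) = 4 * ε * (r ^ n * (W r / (4 * ε) * v r ^ 2)) := by
      field_simp
    rw [e]
    apply mul_le_mul_of_nonneg_left _ (by positivity)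
    simp only [hD]; linarith

end Cfg


lemma edge {W : ℝ → ℝ} (hW : Continuous W) (hW0 : ∀ t, 0 ≤ W t) {R₁ r₁ r₂ : ℝ} (h1 : R₁ < r₁)
    (hWR : 0 < W R₁) (hz : ∀ t ∈ Icc r₁ r₂, W t = 0) (h2 : r₁ ≤ r₂) :
    ∃ ρ, R₁ < ρ ∧ ρ ≤ r₁ ∧ (∀ t ∈ Icc ρ r₂, W t = 0) ∧
      ∀ η > 0, ∃ x, ρ - η < x ∧ x < ρ ∧ 0 < W x := by
  set T : Set ℝ := {x | R₁ ≤ x ∧ x ≤ r₁ ∧ 0 < W x} with hT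
  have hTn : T.Nonempty := ⟨R₁, le_rfl, h1.le, hWR⟩
  have hTb : BddAbove T := ⟨r₁, fun x hx => hx.2.1⟩
  set ρ := sSup T with hρ
  have hRρ : R₁ ≤ ρ := le_csSup hTb ⟨le_rfl, h1.le, hWR⟩
  have hρr : ρ ≤ r₁ := csSup_le hTn fun x hx => hx.2.1
  have hgt : ∀ t, ρ < t → t ≤ r₂ → W t = 0 := by
    intro t ht1 ht2
    rcases le_total r₁ t with h | h
    · exact hz t ⟨h, ht2⟩
    · by_contra hne
      have : t ∈ T := ⟨by linarith, h, lt_of_le_of_ne (hW0 t) (Ne.symm hne)⟩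
      linarith [le_csSup hTb this]
  have hWρ : W ρ = 0 := by
    rcases hρr.eq_or_lt with h | h
    · rw [h]; exact hz r₁ ⟨le_rfl, h2⟩
    · by_contra hne
      have hp : 0 < W ρ := lt_of_le_of_ne (hW0 ρ) (Ne.symm hne)
      have h3 : ∀ᶠ t in 𝓝 ρ, 0 < W t := hW.continuousAt.eventually (lt_mem_nhds hp)
      have h4 : ∀ᶠ t in 𝓝[>] ρ, 0 < W t := h3.filter_mono nhdsWithin_le_nhds
      have h5 : ∀ᶠ t in 𝓝[>] ρ, t ∈ Ioo ρ r₁ := Ioo_mem_nhdsGT h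
      obtain ⟨t, ht1, ht2⟩ := (h4.and h5).exists
      rw [hgt t ht2.1 (ht2.2.le.trans h2)] at ht1
      exact lt_irrefl _ ht1
  refine ⟨ρ, lt_of_le_of_ne hRρ ?_, hρr, ?_, ?_⟩
  · intro h; rw [← h] at hWρ; linarith
  · intro t ht
    rcases ht.1.eq_or_lt with h | h
    · rw [← h]; exact hWρ
    · exact hgt t h ht.2
  · intro η hη
    obtain ⟨x, hx, hx2⟩ := exists_lt_of_lt_csSup hTn (show ρ - η < sSup T by linarith)
    refine ⟨x, hx2, lt_of_le_of_ne (le_csSup hTb hx) ?_, hx.2.2⟩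
    intro h; rw [h] at hx; linarith [hx.2.2]

lemma barrier_exists {W : ℝ → ℝ} (hW : Continuous W) {p q x : ℝ} (hp : p < x) (hq : x < q)
    (hx : 0 < W x) : ∃ b b' m, p < b ∧ b < b' ∧ b' < q ∧ 0 < m ∧ ∀ t ∈ Icc b b', m ≤ W t := by
  have h1 : ∀ᶠ t in 𝓝 x, W x / 2 < W t := hW.continuousAt.eventually (lt_mem_nhds (by linarith))
  have h2 : ∀ᶠ t in 𝓝 x, t ∈ Ioo p q := Ioo_mem_nhds hp hq
  obtain ⟨δ, hδ, hb⟩ := Metric.eventually_nhds_iff.1 (h1.and h2)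
  have h3 : ∀ t ∈ Icc x (x + δ / 2), W x / 2 < W t ∧ t ∈ Ioo p q := by
    intro t ht
    apply hb
    rw [Real.dist_eq, abs_lt]
    constructor <;> linarith [ht.1, ht.2]
  refine ⟨x, x + δ / 2, W x / 2, hp, by linarith, (h3 _ ⟨by linarith, le_rfl⟩).2.2, by linarith, ?_⟩
  intro t ht
  exact (h3 t ht).1.le

lemma cutoff_exists {p b β p' c0 C : ℝ} (hp : p < b) (hβ : β < p') (hc : c0 ≤ C) :
    ∃ lam : ℝ → ℝ, Continuous lam ∧ (∀ t, c0 ≤ lam t) ∧ (∀ t, lam t ≤ C) ∧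
      (∀ t, t ≤ p → lam t = c0) ∧ (∀ t, p' ≤ t → lam t = c0) ∧ ∀ t ∈ Icc b β, lam t = C := by
  obtain ⟨χ, h0, h1, h01⟩ := exists_continuous_zero_one_of_isClosed (s := Iic p ∪ Ici p')
    (t := Icc b β) (isClosed_Iic.union isClosed_Ici) isClosed_Icc (by
      rw [Set.disjoint_left]
      rintro x (hx | hx) hx'
      · exact absurd (hp.trans_le hx'.1) (not_lt.2 hx)
      · exact absurd (hx'.2.trans_lt hβ) (not_lt.2 hx))
  refine ⟨fun t => c0 + (C - c0) * χ t, by fun_prop, fun t => ?_, fun t => ?_, fun t ht => ?_,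
    fun t ht => ?_, fun t ht => ?_⟩
  · have := mul_nonneg (sub_nonneg.2 hc) (h01 t).1
    linarith
  · have := mul_le_mul_of_nonneg_left (h01 t).2 (sub_nonneg.2 hc)
    linarith
  · have := h0 (Or.inl ht : t ∈ Iic p ∪ Ici p')
    simp only [Pi.zero_apply] at this
    beta_reduce; rw [this]; ring
  · have := h0 (Or.inr ht : t ∈ Iic p ∪ Ici p')
    simp only [Pi.zero_apply] at this
    beta_reduce; rw [this]; ring
  · have := h1 ht
    simp only [Pi.one_apply] at this
    beta_reduce; rw [this]; ring

lemma exists_cfg {W S A : ℝ → ℝ} (n : ℕ) {q LA R₁ r₁ r₂ R₂ α : ℝ} (nl : NL S A q LA)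
    (hW : Continuous W) (hW0 : ∀ t, 0 ≤ W t) (hR1 : 0 < R₁) (h1 : R₁ < r₁) (h2 : r₁ < r₂)
    (h3 : r₂ < R₂) (hz : ∀ t ∈ Icc r₁ r₂, W t = 0) (hα : 0 < α)
    (Wi : ∀ t, 0 ≤ t → t ≤ R₁ → α ≤ W t) (Wo : ∀ t, R₂ ≤ t → α ≤ W t) :
    ∃ ρ₁ ρ₂ η b b' β β' c0 C C4 m θ ε₀, ∃ lam : ℝ → ℝ, 0 < ε₀ ∧ ∀ ε, 0 < ε → ε < ε₀ →
      Cfg W S A lam n q LA R₁ ρ₁ ρ₂ R₂ α η b b' β β' c0 C C4 m θ ε := by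
  have hR2 : 0 < R₂ := by linarith
  obtain ⟨ρ₁, hρ1, hρ1r, hz1, he1⟩ := edge hW hW0 h1
    (hα.trans_le (Wi R₁ hR1.le le_rfl)) hz h2.le
  obtain ⟨σ, hσ1, hσ2, hz2, he2⟩ := edge (W := fun t => W (-t)) (R₁ := -R₂) (r₁ := -r₂) (r₂ := -ρ₁)
    (by fun_prop) (fun t => hW0 _) (by linarith) (by simpa using hα.trans_le (Wo R₂ le_rfl))
    (fun t ht => hz1 (-t) ⟨by linarith [ht.2], by linarith [ht.1]⟩) (by linarith)
  set ρ₂ := -σ with hρ2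
  have hρ : ρ₁ < ρ₂ := by linarith
  have hρ2R : ρ₂ < R₂ := by linarith
  have hWz : ∀ t ∈ Icc ρ₁ ρ₂, W t = 0 := by
    intro t ht
    have := hz2 (-t) ⟨by linarith [ht.2], by linarith [ht.1]⟩
    simpa using this
  set κ := R₂ ^ n / R₁ ^ n with hκ
  have hκp : 0 < κ := by positivity
  set c := R₁ ^ n / (8 * R₂ ^ n) with hc
  have hcp : 0 < c := by positivity
  have hℓ : 0 < ρ₂ - ρ₁ := by linarith
  set C4 := 32 * κ / (c * (ρ₂ - ρ₁) ^ 2) with hC4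
  have hC4p : 0 < C4 := by positivity
  set C := max (C4 + 1) ((4 / c) ^ q * C4) with hC
  have hCp : 0 < C := lt_of_lt_of_le (by linarith) (le_max_left _ _)
  set η := min (min (ρ₁ - R₁) (R₂ - ρ₂)) (min R₂ (min 1 (1 / (4 * κ * C)))) with hη
  have hηp : 0 < η := by
    refine lt_min (lt_min (by linarith) (by linarith)) (lt_min hR2 (lt_min one_pos (by positivity)))
  have hη1 : η ≤ ρ₁ - R₁ := (min_le_left _ _).trans (min_le_left _ _)
  have hη2 : η ≤ R₂ - ρ₂ := (min_le_left _ _).trans (min_le_right _ _)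
  have hη3 : η ≤ R₂ := (min_le_right _ _).trans (min_le_left _ _)
  have hη4 : η ≤ 1 := (min_le_right _ _).trans ((min_le_right _ _).trans (min_le_left _ _))
  have hη5 : η ≤ 1 / (4 * κ * C) :=
    (min_le_right _ _).trans ((min_le_right _ _).trans (min_le_right _ _))
  set c0 := min C (1 / (8 * κ * R₂ ^ 2)) with hc0
  have hc0p : 0 < c0 := lt_min hCp (by positivity)
  have hc01 : c0 ≤ C := min_le_left _ _
  have hc02 : c0 ≤ 1 / (8 * κ * R₂ ^ 2) := min_le_right _ _
  have hsm : κ * (c0 * R₂ ^ 2 + (c0 * R₂ + C * η) * η) ≤ 1 / 2 := by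
    have e1 : κ * (c0 * R₂ ^ 2) ≤ 1 / 8 := by
      rw [le_div_iff₀ (by positivity)] at hc02
      linarith
    have e2 : κ * (C * η) ≤ 1 / 4 := by
      rw [le_div_iff₀ (by positivity)] at hη5
      linarith
    have e3 : κ * (c0 * R₂ * η) ≤ κ * (c0 * R₂ ^ 2) := by
      rw [pow_two, ← mul_assoc c0 R₂ R₂]
      gcongr
    have e4 : κ * (C * η * η) ≤ κ * (C * η) := by
      apply mul_le_mul_of_nonneg_left _ hκp.le
      exact mul_le_of_le_one_right (by positivity) hη4
    nlinarith
  obtain ⟨x1, hx1, hx1', hx1W⟩ := he1 η hηp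
  obtain ⟨b, b', m1, hb1, hb2, hb3, hm1, hWm1⟩ := barrier_exists hW hx1 hx1' hx1W
  obtain ⟨x2, hx2, hx2', hx2W⟩ := he2 η hηp
  obtain ⟨β, β', m2, hβ1, hβ2, hβ3, hm2, hWm2⟩ := barrier_exists hW (p := ρ₂) (q := ρ₂ + η)
    (x := -x2) (by linarith) (by linarith) hx2W
  set m := min m1 m2 with hm
  have hmp : 0 < m := lt_min hm1 hm2
  set θ := (c0 / C) ^ (1 / q) with hθ
  have hθp : 0 < θ := by positivity
  have hq := nl.hq
  have hθC : θ ^ q * C ≤ c0 := by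
    rw [hθ, ← Real.rpow_mul (by positivity), one_div, inv_mul_cancel₀ hq.ne', Real.rpow_one]
    rw [div_mul_cancel₀ _ hCp.ne']
  obtain ⟨lam, lc, l1, l2, lL, lR, lM⟩ := cutoff_exists (p := ρ₁ - η) (b := b) (β := β')
    (p' := ρ₂ + η) hb1 hβ3 hc01
  -- the barrier constants
  have hbarK : ∀ d, 0 < d → ∃ e > 0, ∀ ε, 0 < ε → ε < e →
      2 / θ ≤ m / (4 * ε) * R₁ ^ n / (4 * R₂ ^ n) * d ^ 2
        - (R₂ ^ n * (c0 + C) * R₂ * 2) / R₁ ^ n * d := by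
    intro d hd
    set Y := 2 / θ + (R₂ ^ n * (c0 + C) * R₂ * 2) / R₁ ^ n * d with hY
    have hYp : 0 < Y := by positivity
    set X := m / 4 * R₁ ^ n / (4 * R₂ ^ n) * d ^ 2 with hX
    have hXp : 0 < X := by positivity
    refine ⟨X / Y, by positivity, fun ε h0 he => ?_⟩
    have e : m / (4 * ε) * R₁ ^ n / (4 * R₂ ^ n) * d ^ 2 = X / ε := by
      rw [hX]; field_simp
    rw [e]
    have : Y ≤ X / ε := by
      rw [le_div_iff₀ h0]
      rw [lt_div_iff₀ hYp] at he
      linarith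
    linarith
  obtain ⟨e1, he1p, hbar1⟩ := hbarK (b' - b) (by linarith)
  obtain ⟨e2, he2p, hbar2⟩ := hbarK (β' - β) (by linarith)
  set ε₀ := min (min e1 e2) (min (min (α / (2 * C)) (m / (2 * C))) (min (1 / C) ((1 / 2) ^ q / C4)))
    with hε₀
  have hp : (0:ℝ) < (1 / 2) ^ q := by positivity
  refine ⟨ρ₁, ρ₂, η, b, b', β, β', c0, C, C4, m, θ, ε₀, lam, ?_, ?_⟩
  · refine lt_min (lt_min he1p he2p) (lt_min (lt_min ?_ ?_) (lt_min ?_ ?_)) <;> positivity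
  intro ε hε hlt
  rw [hε₀, lt_min_iff, lt_min_iff, lt_min_iff, lt_min_iff, lt_min_iff] at hlt
  obtain ⟨⟨k1, k2⟩, ⟨k3, k4⟩, k5, k6⟩ := hlt
  rw [lt_div_iff₀ (by positivity)] at k3 k4 k5 k6
  exact
    { nl := nl, hR1 := hR1, hRρ := by linarith, hη := hηp, hb1 := hb1, hb2 := hb2, hb3 := hb3,
      hρ := hρ, hβ1 := hβ1, hβ2 := hβ2, hβ3 := hβ3, hρR := by linarith, Wc := hW, W0 := hW0,
      Wz := hWz, Wm1 := fun t ht => (min_le_left _ _).trans (hWm1 t ht),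
      Wm2 := fun t ht => (min_le_right _ _).trans (hWm2 t ht), hα := hα, Wi := Wi, Wo := Wo,
      lc := lc, l1 := l1, l2 := l2, lL := lL, lR := lR, lM := lM, hc0 := hc0p, hC := hCp,
      hsm := hsm,
      hC4 := by rw [hC4, div_mul_cancel₀ _ (by positivity)],
      hC4C := lt_of_lt_of_le (by linarith) (le_max_left _ _),
      hC4q := le_max_right _ _, hθ := hθp, hθC := hθC, hm := hmp, hε := hε,
      hεα := by linarith, hεm := by linarith, hεC := by linarith, hε4 := by linarith,
      bar1 := hbar1 ε hε k1, bar2 := hbar2 ε hε k2 }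

/-- The radial theorem. -/
theorem radial {W S A : ℝ → ℝ} (n : ℕ) {q LA R₁ r₁ r₂ R₂ α : ℝ} (nl : NL S A q LA)
    (hW : Continuous W) (hW0 : ∀ t, 0 ≤ W t) (hR1 : 0 < R₁) (h1 : R₁ < r₁) (h2 : r₁ < r₂)
    (h3 : r₂ < R₂) (hz : ∀ t ∈ Icc r₁ r₂, W t = 0) (hα : 0 < α)
    (Wi : ∀ t, 0 ≤ t → t ≤ R₁ → α ≤ W t) (Wo : ∀ t, R₂ ≤ t → α ≤ W t) :
    ∃ ε₀ : ℝ, 0 < ε₀ ∧ ∀ ε, 0 < ε → ε < ε₀ → ∃ (a : ℝ) (v g : ℝ → ℝ), 0 < a ∧ Continuous v ∧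
      Continuous g ∧ (∀ r, 0 ≤ r → v r = a + ∫ s in (0:ℝ)..r, s * kAvg n g s) ∧
      (∀ r, HasDerivAt (fun r => r ^ (n + 1) * kAvg n g r) (r ^ n * g r) r) ∧
      (∀ r, 0 ≤ r → 0 ≤ v r ∧ v r ≤ 1 ∧ g r = S (v r) * (W r - A (v r)) / ε) ∧
      Tendsto v atTop (𝓝 0) ∧
      IntegrableOn (fun r => r ^ n * (r * kAvg n g r) ^ 2) (Ioi 0) ∧
      IntegrableOn (fun r => r ^ n * (W r * v r ^ 2)) (Ioi 0) := by
  obtain ⟨ρ₁, ρ₂, η, b, b', β, β', c0, C, C4, m, θ, ε₀, lam, hε₀, hcfg⟩ :=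
    exists_cfg n nl hW hW0 hR1 h1 h2 h3 hz hα Wi Wo
  refine ⟨ε₀, hε₀, fun ε hε hlt => ?_⟩
  have hc := hcfg ε hε hlt
  obtain ⟨a, v, z, ha, hs, hv, hzz, hlim, hG⟩ := hc.exists_sol
  obtain ⟨i1, i2⟩ := hc.integrable_sol hs hv hzz
  refine ⟨a, v, fun t => GG W S A lam ε t (v t), ha, hs.vc,
    hc.G_cont.comp (continuous_id.prodMk hs.vc), hs.vint, ?_,
    fun r hr => ⟨hv r hr, (hG r hr).1, (hG r hr).2⟩, hlim, i1, i2⟩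
  intro r
  have := hs.dz r
  rwa [show z = fun r => r ^ (n + 1) * kAvg n (fun t => GG W S A lam ε t (v t)) r from
    funext hs.zk] at this


lemma h_hasDerivAt (u : ℝ) : HasDerivAt h (Real.sqrt (1 + u ^ 2)) u := by
  have hp : 0 < 1 + u ^ 2 := by positivity
  have h1 : HasDerivAt (fun u : ℝ => Real.sqrt (1 + u ^ 2)) (u / Real.sqrt (1 + u ^ 2)) u := by
    have := ((hasDerivAt_pow 2 u).const_add 1).sqrt hp.ne'
    have e : ((2 : ℕ) : ℝ) * u ^ (2 - 1) / (2 * Real.sqrt (1 + u ^ 2)) = u / Real.sqrt (1 + u ^ 2) := by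
      rw [show (2:ℕ) - 1 = 1 from rfl, pow_one]; push_cast; field_simp
    rwa [e] at this
  have h2 := ((hasDerivAt_id u).const_mul (1 / 2)).mul h1
  have h3 := (Real.hasDerivAt_arsinh u).const_mul (1 / 2)
  have h4 := h2.add h3
  have hs : 0 < Real.sqrt (1 + u ^ 2) := Real.sqrt_pos.2 hp
  have e : 1 / 2 * 1 * Real.sqrt (1 + u ^ 2) + 1 / 2 * id u * (u / Real.sqrt (1 + u ^ 2)) +
      1 / 2 * (Real.sqrt (1 + u ^ 2))⁻¹ = Real.sqrt (1 + u ^ 2) := by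
    have := Real.sq_sqrt hp.le
    simp only [id]
    field_simp
    linarith
  rw [e] at h4
  exact h4

lemma h_zero : h 0 = 0 := by simp [h]

lemma h_cont : Continuous h := continuous_iff_continuousAt.2 fun u => (h_hasDerivAt u).continuousAt

lemma h_lower {a b : ℝ} (hab : a ≤ b) : b - a ≤ h b - h a := by
  have := cmp_lower (f := h) (c := 1) hab (fun x _ => h_hasDerivAt x) (by
    intro x _
    rw [Real.one_le_sqrt]
    nlinarith [sq_nonneg x])
  linarith

lemma h_upper {u : ℝ} (hu : 0 ≤ u) : h u ≤ u * Real.sqrt (1 + u ^ 2) := by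
  have := cmp_upper (f := h) (c := Real.sqrt (1 + u ^ 2)) hu (fun x _ => h_hasDerivAt x) (by
    intro x hx
    apply Real.sqrt_le_sqrt
    have := pow_le_pow_left₀ hx.1 hx.2 2
    linarith)
  rw [h_zero] at this
  linarith

lemma h_strictMono : StrictMono h := by
  intro a b hab
  linarith [h_lower hab.le]

section inv
variable {f : ℝ → ℝ}

lemma f_lip (hf : Function.RightInverse f h) (x y : ℝ) : |f x - f y| ≤ |x - y| := by
  wlog hxy : f y ≤ f x generalizing x y
  · rw [abs_sub_comm, abs_sub_comm x y]; exact this y x (le_of_not_ge hxy)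
  have := h_lower hxy
  rw [hf x, hf y] at this
  rw [abs_of_nonneg (by linarith)]
  exact this.trans (le_abs_self _)

lemma f_zero (hf : Function.LeftInverse f h) : f 0 = 0 := by
  have := hf 0
  rwa [h_zero] at this

lemma f_mono (hf : Function.RightInverse f h) : Monotone f := by
  intro x y hxy
  by_contra hcon
  push Not at hcon
  have := h_strictMono hcon
  rw [hf x, hf y] at this
  linarith

lemma f_nonneg (hf1 : Function.LeftInverse f h) (hf : Function.RightInverse f h) {x : ℝ}
    (hx : 0 ≤ x) : 0 ≤ f x := by
  have := f_mono hf hx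
  rwa [f_zero hf1] at this

lemma f_le (hf1 : Function.LeftInverse f h) (hf : Function.RightInverse f h) {x : ℝ}
    (hx : 0 ≤ x) : f x ≤ x := by
  have := h_lower (f_nonneg hf1 hf hx)
  rw [hf x, h_zero] at this
  linarith

lemma f_two (hf : Function.RightInverse f h) : 1 ≤ f 2 := by
  by_contra hcon
  push Not at hcon
  have h1 := h_strictMono hcon
  rw [hf 2] at h1
  have h2 := h_upper zero_le_one
  have h3 : Real.sqrt (1 + 1 ^ 2) < 2 := by
    rw [Real.sqrt_lt' (by norm_num)]; norm_num
  linarith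

lemma f_small (hf1 : Function.LeftInverse f h) (hf : Function.RightInverse f h) {x : ℝ}
    (hx : 0 ≤ x) (hx1 : x ≤ 1) :
    x / 2 ≤ f x / Real.sqrt (1 + f x ^ 2) ∧ x / 2 ≤ f x := by
  have h0 := f_nonneg hf1 hf hx
  have h1 := (f_le hf1 hf hx).trans hx1
  have h2 := h_upper h0
  rw [hf x] at h2
  have hp : 0 < 1 + f x ^ 2 := by positivity
  set s := Real.sqrt (1 + f x ^ 2) with hs
  have hs0 : 0 < s := Real.sqrt_pos.2 hp
  have hs2 : s ^ 2 = 1 + f x ^ 2 := Real.sq_sqrt hp.le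
  have hs1 : s ^ 2 ≤ 2 := by nlinarith
  have h3 : x / 2 ≤ f x / s := by
    rw [le_div_iff₀ hs0]
    have h5 : x * s ≤ f x * s ^ 2 := by nlinarith
    have h6 : f x * s ^ 2 ≤ f x * 2 := by gcongr
    linarith
  refine ⟨h3, h3.trans ?_⟩
  apply div_le_self h0
  rw [hs, Real.one_le_sqrt]
  nlinarith [sq_nonneg (f x)]

lemma psi_lip (a b : ℝ) : |a / Real.sqrt (1 + a ^ 2) - b / Real.sqrt (1 + b ^ 2)| ≤ |a - b| := by
  rw [← Real.sin_arctan, ← Real.sin_arctan]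
  have := Convex.norm_image_sub_le_of_norm_hasDerivWithin_le (f := fun x => Real.sin (Real.arctan x))
    (f' := fun x => Real.cos (Real.arctan x) * (1 / (1 + x ^ 2))) (C := 1) (s := univ) (x := b) (y := a)
    (fun x _ => ((Real.hasDerivAt_sin _).comp x (Real.hasDerivAt_arctan x)).hasDerivWithinAt)
    (by
      intro x _
      rw [norm_mul]
      have h1 : ‖Real.cos (Real.arctan x)‖ ≤ 1 := Real.abs_cos_le_one _
      have h2 : ‖1 / (1 + x ^ 2)‖ ≤ 1 := by
        rw [Real.norm_of_nonneg (by positivity)]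
        rw [div_le_one (by positivity)]
        nlinarith [sq_nonneg x]
      exact mul_le_one₀ h1 (norm_nonneg _) h2) convex_univ (mem_univ _) (mem_univ _)
  simpa using this

lemma pow_lip {q : ℝ} (hq : 1 ≤ q) {a b : ℝ} (ha : 0 ≤ a) (ha1 : a ≤ 1) (hb : 0 ≤ b) (hb1 : b ≤ 1) :
    |a ^ q - b ^ q| ≤ q * |a - b| := by
  have := Convex.norm_image_sub_le_of_norm_hasDerivWithin_le (f := fun x : ℝ => x ^ q)
    (f' := fun x => q * x ^ (q - 1)) (C := q) (s := Icc 0 1) (x := b) (y := a)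
    (fun x _ => (Real.hasDerivAt_rpow_const (Or.inr hq)).hasDerivWithinAt)
    (by
      intro x hx
      have h0 : 0 ≤ x ^ (q - 1) := Real.rpow_nonneg hx.1 _
      rw [Real.norm_of_nonneg (by positivity)]
      apply mul_le_of_le_one_right (by linarith)
      exact Real.rpow_le_one hx.1 hx.2 (by linarith)) (convex_Icc 0 1) ⟨hb, hb1⟩ ⟨ha, ha1⟩
  simpa using this

/-- regularised product of f and its derivative -/
noncomputable def SS (f : ℝ → ℝ) (x : ℝ) : ℝ :=
  max (f (max x 0) / Real.sqrt (1 + f (max x 0) ^ 2)) (max x 0 / 2)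

/-- regularised `f ^ q` -/
noncomputable def AA (f : ℝ → ℝ) (q x : ℝ) : ℝ := (min (f (max x 0)) 1) ^ q

lemma SS_eq (hf1 : Function.LeftInverse f h) (hf : Function.RightInverse f h) {x : ℝ}
    (hx : 0 ≤ x) (hx1 : x ≤ 1) : SS f x = f x / Real.sqrt (1 + f x ^ 2) := by
  rw [SS, max_eq_left hx, max_eq_left (f_small hf1 hf hx hx1).1]

lemma AA_eq (hf1 : Function.LeftInverse f h) (hf : Function.RightInverse f h) {q x : ℝ}
    (hx : 0 ≤ x) (hx1 : x ≤ 1) : AA f q x = f x ^ q := by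
  rw [AA, max_eq_left hx, min_eq_left ((f_le hf1 hf hx).trans hx1)]

lemma nl_f (hf1 : Function.LeftInverse f h) (hf : Function.RightInverse f h) {q : ℝ} (hq : 1 ≤ q) :
    NL (SS f) (AA f q) q q := by
  have hm : ∀ x y : ℝ, |max x 0 - max y 0| ≤ |x - y| := fun x y =>
    by simpa using abs_max_sub_max_le_max x 0 y 0
  have hb0 : ∀ x, 0 ≤ min (f (max x 0)) 1 := fun x =>
    le_min (f_nonneg hf1 hf (le_max_right _ _)) zero_le_one
  have hbm : Monotone fun x => min (f (max x 0)) 1 := by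
    intro x y hxy
    exact min_le_min_right 1 (f_mono hf (max_le_max_right 0 hxy))
  have hq0 : 0 < q := by linarith
  refine ⟨hq0, ?_, ?_, ?_, ?_, ?_, ?_, ?_, hq0.le, ?_, ?_, ?_⟩
  · intro x y
    refine (abs_max_sub_max_le_max _ _ _ _).trans (max_le ?_ ?_)
    · exact (psi_lip _ _).trans ((f_lip hf _ _).trans (hm x y))
    · rw [← sub_div, abs_div, abs_two]
      have := hm x y
      have := abs_nonneg (x - y)
      linarith
  · intro x hx
    rw [SS, max_eq_right hx, f_zero hf1]; simp
  · intro x hx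
    rw [SS, max_eq_left hx]; exact le_max_right _ _
  · intro x hx
    rw [SS, max_eq_left hx]
    refine max_le ?_ (by linarith)
    refine le_trans (div_le_self (f_nonneg hf1 hf hx) ?_) (f_le hf1 hf hx)
    rw [Real.one_le_sqrt]
    nlinarith [sq_nonneg (f x)]
  · intro x; exact Real.rpow_nonneg (hb0 x) q
  · intro x y hxy
    exact Real.rpow_le_rpow (hb0 x) (hbm hxy) hq0.le
  · intro x y
    refine (pow_lip hq (hb0 x) (min_le_right _ _) (hb0 y) (min_le_right _ _)).trans ?_
    apply mul_le_mul_of_nonneg_left _ hq0.le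
    refine (abs_min_sub_min_le_max _ _ _ _).trans ?_
    simp only [sub_self, abs_zero]
    exact max_le ((f_lip hf _ _).trans (hm x y)) (abs_nonneg _)
  · intro x hx
    apply Real.rpow_le_rpow (hb0 x) _ hq0.le
    rw [max_eq_left hx]
    exact (min_le_left _ _).trans (f_le hf1 hf hx)
  · intro x hx hx1
    rw [AA_eq hf1 hf hx hx1]
    exact Real.rpow_le_rpow (by linarith) (f_small hf1 hf hx hx1).2 hq0.le
  · intro x hx
    have h1 : ∀ y, 2 ≤ y → AA f q y = 1 := by
      intro y hy
      rw [AA, max_eq_left (by linarith), min_eq_right ((f_two hf).trans (f_mono hf hy)), Real.one_rpow]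
    rw [h1 x hx, h1 2 le_rfl]

end inv


section transfer
variable {N : ℕ}

lemma norm_hasFDerivAt {x : EuclideanSpace ℝ (Fin N)} (hx : x ≠ 0) :
    HasFDerivAt (fun y : EuclideanSpace ℝ (Fin N) => ‖y‖) ((1 / ‖x‖) • innerSL ℝ x) x := by
  have hp : 0 < ‖x‖ := norm_pos_iff.2 hx
  have h1 := ((hasStrictFDerivAt_norm_sq x).hasFDerivAt).sqrt (by positivity)
  have e1 : (fun y : EuclideanSpace ℝ (Fin N) => Real.sqrt (‖y‖ ^ 2)) = fun y => ‖y‖ := by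
    funext y; exact Real.sqrt_sq (norm_nonneg y)
  rw [e1, Real.sqrt_sq (norm_nonneg x)] at h1
  have e2 : (1 / (2 * ‖x‖)) • (2 • innerSL ℝ x) = (1 / ‖x‖) • innerSL ℝ x := by
    ext y
    simp only [smul_apply, smul_eq_mul, nsmul_eq_mul]
    push_cast
    field_simp
  rwa [e2] at h1

lemma vhat_hasFDerivAt {v k : ℝ → ℝ} {a : ℝ} (hk : Continuous k)
    (hv : ∀ r, 0 ≤ r → v r = a + ∫ s in (0:ℝ)..r, s * k s) (x : EuclideanSpace ℝ (Fin N)) :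
    HasFDerivAt (fun y : EuclideanSpace ℝ (Fin N) => v ‖y‖) (k ‖x‖ • innerSL ℝ x) x := by
  set Ψ : ℝ → ℝ := fun t => a + (1 / 2) * ∫ τ in (0:ℝ)..t, k (Real.sqrt τ) with hΨ
  have hkc : Continuous fun τ => k (Real.sqrt τ) := hk.comp Real.continuous_sqrt
  have hΨd : ∀ t, HasDerivAt Ψ ((1 / 2) * k (Real.sqrt t)) t := fun t =>
    ((intervalIntegral.integral_hasDerivAt_right (hkc.intervalIntegrable _ _)
        (hkc.stronglyMeasurableAtFilter _ _) hkc.continuousAt).const_mul (1 / 2)).const_add a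
  have hsk : Continuous fun s => s * k s := by fun_prop
  have hFd : ∀ r, HasDerivAt (fun r => a + ∫ s in (0:ℝ)..r, s * k s) (r * k r) r := fun r =>
    (intervalIntegral.integral_hasDerivAt_right (hsk.intervalIntegrable _ _)
        (hsk.stronglyMeasurableAtFilter _ _) hsk.continuousAt).const_add a
  have hΨ2 : ∀ r, 0 ≤ r → HasDerivAt (fun r => Ψ (r ^ 2)) (r * k r) r := by
    intro r hr
    have h1 := (hΨd (r ^ 2)).comp r (hasDerivAt_pow 2 r)
    have e : (1 / 2) * k (Real.sqrt (r ^ 2)) * (((2 : ℕ) : ℝ) * r ^ (2 - 1)) = r * k r := by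
      rw [Real.sqrt_sq hr, show (2:ℕ) - 1 = 1 from rfl]; push_cast; ring
    rw [e] at h1
    exact h1
  have heq : ∀ r, 0 ≤ r → v r = Ψ (r ^ 2) := by
    intro r hr
    rw [hv r hr]
    have h1 := cmp_lower (f := fun r => (a + ∫ s in (0:ℝ)..r, s * k s) - Ψ (r ^ 2)) (c := 0) hr
      (fun x hx => (hFd x).sub (hΨ2 x hx.1)) (fun x _ => by simp)
    have h2 := cmp_upper (f := fun r => (a + ∫ s in (0:ℝ)..r, s * k s) - Ψ (r ^ 2)) (c := 0) hr
      (fun x hx => (hFd x).sub (hΨ2 x hx.1)) (fun x _ => by simp)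
    have e0 : (a + ∫ s in (0:ℝ)..0, s * k s) - Ψ (0 ^ 2) = 0 := by simp [hΨ]
    beta_reduce at h1 h2
    rw [e0] at h1 h2
    linarith
  have e : (fun y : EuclideanSpace ℝ (Fin N) => v ‖y‖) = fun y => Ψ (‖y‖ ^ 2) := by
    funext y; exact heq _ (norm_nonneg y)
  rw [e]
  have h1 := (hΨd (‖x‖ ^ 2)).comp_hasFDerivAt x (hasStrictFDerivAt_norm_sq x).hasFDerivAt
  have e2 : ((1 / 2) * k (Real.sqrt (‖x‖ ^ 2))) • (2 • innerSL ℝ x) = k ‖x‖ • innerSL ℝ x := by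
    rw [Real.sqrt_sq (norm_nonneg x)]
    ext y
    simp only [smul_apply, smul_eq_mul, nsmul_eq_mul]
    push_cast
    ring
  rw [e2] at h1
  exact h1

lemma innerSL_single (x : EuclideanSpace ℝ (Fin N)) (i : Fin N) :
    innerSL ℝ x (EuclideanSpace.single i 1) = x i := by
  rw [innerSL_apply_apply, EuclideanSpace.inner_single_right]
  simp

/-- Partial derivative of `k(|x|) x_i`. -/
noncomputable def pd (N : ℕ) (k g : ℝ → ℝ) (i : Fin N) (x : EuclideanSpace ℝ (Fin N)) : ℝ :=
  k ‖x‖ + (g ‖x‖ - N * k ‖x‖) * (x i ^ 2 / ‖x‖ ^ 2)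

lemma comp_hasFDerivAt {n : ℕ} (hN : N = n + 1) {k g : ℝ → ℝ} (hk : Continuous k)
    (hd : ∀ r, HasDerivAt (fun r => r ^ (n + 1) * k r) (r ^ n * g r) r) (i : Fin N)
    (x : EuclideanSpace ℝ (Fin N)) :
    ∃ L : EuclideanSpace ℝ (Fin N) →L[ℝ] ℝ,
      HasFDerivAt (fun y : EuclideanSpace ℝ (Fin N) => k ‖y‖ * y i) L x ∧
      L (EuclideanSpace.single i 1) = pd N k g i x := by
  have hproj : ∀ x, HasFDerivAt (fun y : EuclideanSpace ℝ (Fin N) => y i)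
      (EuclideanSpace.proj i : EuclideanSpace ℝ (Fin N) →L[ℝ] ℝ) x :=
    fun x => (EuclideanSpace.proj i : EuclideanSpace ℝ (Fin N) →L[ℝ] ℝ).hasFDerivAt
  have hps : (EuclideanSpace.proj i : EuclideanSpace ℝ (Fin N) →L[ℝ] ℝ)
      (EuclideanSpace.single i 1) = 1 := by
    simp
  rcases eq_or_ne x 0 with rfl | hx
  · refine ⟨k 0 • (EuclideanSpace.proj i : EuclideanSpace ℝ (Fin N) →L[ℝ] ℝ), ?_, ?_⟩
    · rw [hasFDerivAt_iff_isLittleO_nhds_zero]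
      have h1 : (fun y : EuclideanSpace ℝ (Fin N) => k ‖y‖ - k 0) =o[𝓝 0] fun _ => (1:ℝ) := by
        rw [Asymptotics.isLittleO_one_iff]
        have : Continuous fun y : EuclideanSpace ℝ (Fin N) => k ‖y‖ - k 0 := by fun_prop
        have := this.tendsto 0
        simpa using this
      have h2 : (fun y : EuclideanSpace ℝ (Fin N) => y i) =O[𝓝 0] fun y => y :=
        Asymptotics.IsBigO.of_bound 1 (Eventually.of_forall fun y => by
          rw [one_mul]; exact PiLp.norm_apply_le y i)
      have h3 := h1.mul_isBigO h2.norm_right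
      refine (Asymptotics.isLittleO_norm_right.1 (h3.congr ?_ ?_))
      · intro y
        simp
        ring
      · intro y; simp
    · simp [pd]
  · have hp : 0 < ‖x‖ := norm_pos_iff.2 hx
    set r := ‖x‖ with hr
    have hkd : HasDerivAt k ((g r - N * k r) / r) r := by
      have h1 := (hd r).div (hasDerivAt_pow (n + 1) r) (by positivity)
      have e : (r ^ n * g r * r ^ (n + 1) - r ^ (n + 1) * k r * (((n + 1 : ℕ) : ℝ) * r ^ (n + 1 - 1))) /
          (r ^ (n + 1)) ^ 2 = (g r - N * k r) / r := by
        rw [hN, Nat.add_sub_cancel]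
        field_simp
        ring
      rw [e] at h1
      refine h1.congr_of_eventuallyEq ?_
      filter_upwards [lt_mem_nhds hp] with s hs
      simp only [Pi.div_apply]
      field_simp
    have h1 := hkd.comp_hasFDerivAt x (norm_hasFDerivAt hx)
    have h2 := h1.fun_mul (hproj x)
    refine ⟨_, h2, ?_⟩
    simp only [add_apply, smul_apply, smul_eq_mul, innerSL_single, hps, Function.comp, pd]
    rw [← hr]
    field_simp

lemma sum_pd {k g : ℝ → ℝ} (h0 : k 0 * N = g 0)
    (x : EuclideanSpace ℝ (Fin N)) : ∑ i, pd N k g i x = g ‖x‖ := by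
  unfold pd
  rw [Finset.sum_add_distrib, ← Finset.mul_sum, ← Finset.sum_div, ← EuclideanSpace.real_norm_sq_eq]
  simp only [Finset.sum_const, Finset.card_univ, Fintype.card_fin, nsmul_eq_mul]
  rcases eq_or_ne x 0 with rfl | hx
  · simp; linarith
  · have hp : 0 < ‖x‖ := norm_pos_iff.2 hx
    field_simp
    ring

lemma kAvg_zero (n : ℕ) (g : ℝ → ℝ) : kAvg n g 0 * ((n + 1 : ℕ) : ℝ) = g 0 := by
  unfold kAvg
  simp only [zero_mul]
  rw [intervalIntegral.integral_mul_const, integral_pow]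
  push_cast
  have : (n : ℝ) + 1 ≠ 0 := by positivity
  field_simp
  simp

lemma int_cs {F : EuclideanSpace ℝ (Fin N) → ℝ} (hF : Continuous F)
    {φ : EuclideanSpace ℝ (Fin N) → ℝ} (hφ : Continuous φ) (hc : HasCompactSupport φ) :
    Integrable (fun x => F x * φ x) :=
  (hF.mul hφ).integrable_of_hasCompactSupport hc.mul_left

lemma weak_grad {v k : ℝ → ℝ} {a : ℝ} (hvc : Continuous v) (hk : Continuous k)
    (hv : ∀ r, 0 ≤ r → v r = a + ∫ s in (0:ℝ)..r, s * k s)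
    {φ : EuclideanSpace ℝ (Fin N) → ℝ} (hφ : ContDiff ℝ (⊤ : ℕ∞) φ) (hc : HasCompactSupport φ)
    (i : Fin N) :
    ∫ x, v ‖x‖ * fderiv ℝ φ x (EuclideanSpace.single i 1)
      = -∫ x : EuclideanSpace ℝ (Fin N), k ‖x‖ * x i * φ x := by
  have hd := fun x => vhat_hasFDerivAt (N := N) hk hv x
  have hfd : ∀ x : EuclideanSpace ℝ (Fin N),
      fderiv ℝ (fun y : EuclideanSpace ℝ (Fin N) => v ‖y‖) x (EuclideanSpace.single i 1)
        = k ‖x‖ * x i := by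
    intro x
    rw [(hd x).fderiv, smul_apply, innerSL_single, smul_eq_mul]
  have hφd : Continuous fun x => fderiv ℝ φ x (EuclideanSpace.single i 1) :=
    (hφ.continuous_fderiv (by simp)).clm_apply continuous_const
  have := integral_mul_fderiv_eq_neg_fderiv_mul_of_integrable (μ := volume)
    (f := fun y : EuclideanSpace ℝ (Fin N) => v ‖y‖) (g := φ) (v := EuclideanSpace.single i 1)
    (by
      simp only [hfd]
      exact int_cs (by fun_prop) hφ.continuous hc)
    (int_cs (by fun_prop) hφd (hc.fderiv_apply ℝ _))
    (int_cs (by fun_prop) hφ.continuous hc)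
    (fun x _ => (hd x).differentiableAt) (fun x _ => (hφ.differentiable (by simp)) x)
  simp only [hfd] at this
  exact this

lemma int_pd {k g : ℝ → ℝ} (hk : Continuous k) (hg : Continuous g) (i : Fin N)
    {φ : EuclideanSpace ℝ (Fin N) → ℝ} (hφ : Continuous φ) (hc : HasCompactSupport φ) :
    Integrable fun x => pd N k g i x * φ x := by
  have hb := (int_cs (F := fun x : EuclideanSpace ℝ (Fin N) => |k ‖x‖| + |g ‖x‖ - N * k ‖x‖|)
    (by fun_prop) hφ hc).norm
  refine hb.mono' ?_ ?_
  · apply Measurable.aestronglyMeasurable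
    have h1 : Measurable fun x : EuclideanSpace ℝ (Fin N) => x i := by fun_prop
    have h2 := hk.measurable
    have h3 := hg.measurable
    have h4 := hφ.measurable
    unfold pd
    fun_prop
  · refine Eventually.of_forall fun x => ?_
    rw [norm_mul, norm_mul]
    apply mul_le_mul_of_nonneg_right _ (norm_nonneg _)
    rw [Real.norm_eq_abs, Real.norm_eq_abs, abs_of_nonneg (a := |k ‖x‖| + _) (by positivity)]
    unfold pd
    refine (abs_add_le _ _).trans ?_
    refine add_le_add le_rfl ?_
    rw [abs_mul]
    apply mul_le_of_le_one_right (abs_nonneg _)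
    rw [abs_of_nonneg (by positivity)]
    apply div_le_one_of_le₀ _ (by positivity)
    rw [EuclideanSpace.real_norm_sq_eq]
    exact Finset.single_le_sum (f := fun j => x j ^ 2) (fun j _ => sq_nonneg _) (Finset.mem_univ i)

lemma weak_div {n : ℕ} (hN : N = n + 1) {k g : ℝ → ℝ} (hk : Continuous k) (hg : Continuous g)
    (h0 : k 0 * N = g 0)
    (hd : ∀ r, HasDerivAt (fun r => r ^ (n + 1) * k r) (r ^ n * g r) r)
    {φ : EuclideanSpace ℝ (Fin N) → ℝ} (hφ : ContDiff ℝ (⊤ : ℕ∞) φ) (hc : HasCompactSupport φ) :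
    ∫ x : EuclideanSpace ℝ (Fin N), (inner ℝ (k ‖x‖ • x) (gradient φ x) : ℝ)
      = -∫ x : EuclideanSpace ℝ (Fin N), g ‖x‖ * φ x := by
  have hφd : ∀ i, Continuous fun x => fderiv ℝ φ x (EuclideanSpace.single i 1) := fun i =>
    (hφ.continuous_fderiv (by simp)).clm_apply continuous_const
  have hin : ∀ x : EuclideanSpace ℝ (Fin N), (inner ℝ (k ‖x‖ • x) (gradient φ x) : ℝ) =
      ∑ i, k ‖x‖ * x i * fderiv ℝ φ x (EuclideanSpace.single i 1) := by
    intro x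
    rw [real_inner_comm, inner_gradient_left]
    have hx : x = ∑ i, x i • EuclideanSpace.single i (1:ℝ) := by
      ext j
      simp [Finset.sum_apply, Pi.single_apply]
    conv_lhs => rw [map_smul]; arg 2; arg 2; rw [hx]
    rw [map_sum, Finset.smul_sum]
    refine Finset.sum_congr rfl fun i _ => ?_
    rw [map_smul, smul_eq_mul, smul_eq_mul]
    ring
  have hpar : ∀ i : Fin N, ∫ x : EuclideanSpace ℝ (Fin N),
      k ‖x‖ * x i * fderiv ℝ φ x (EuclideanSpace.single i 1) =
      -∫ x : EuclideanSpace ℝ (Fin N), pd N k g i x * φ x := by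
    intro i
    choose L hL hL2 using comp_hasFDerivAt hN hk hd i
    have hfd : ∀ x : EuclideanSpace ℝ (Fin N),
        fderiv ℝ (fun y : EuclideanSpace ℝ (Fin N) => k ‖y‖ * y i) x (EuclideanSpace.single i 1)
          = pd N k g i x := by
      intro x
      rw [(hL x).fderiv, hL2]
    have := integral_mul_fderiv_eq_neg_fderiv_mul_of_integrable (μ := volume)
      (f := fun y : EuclideanSpace ℝ (Fin N) => k ‖y‖ * y i) (g := φ) (v := EuclideanSpace.single i 1)
      (by
        simp only [hfd]
        exact int_pd hk hg i hφ.continuous hc)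
      (int_cs (by fun_prop) (hφd i) (hc.fderiv_apply ℝ _))
      (int_cs (by fun_prop) hφ.continuous hc)
      (fun x _ => (hL x).differentiableAt) (fun x _ => (hφ.differentiable (by simp)) x)
    simp only [hfd] at this
    exact this
  simp only [hin]
  rw [integral_finsetSum _ fun i _ => int_cs (by fun_prop) (hφd i) (hc.fderiv_apply ℝ _)]
  simp only [hpar]
  rw [Finset.sum_neg_distrib, ← integral_finsetSum _ fun i _ => int_pd hk hg i hφ.continuous hc]
  congr 1
  refine integral_congr_ae (Eventually.of_forall fun x => ?_)
  beta_reduce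
  rw [← Finset.sum_mul, sum_pd h0]

end transfer


end helpers

/-- Main theorem (Theorem 1.1, weak formulation): under the geometric assumptions on
the radial potential `V`, there is `ε₀ > 0` such that for each `ε ∈ (0, ε₀)` the
critical-exponent quasilinear problem has a nonnegative, radial, continuous, nontrivial
weak solution `v` (in the transformed variable, `u = f(v)`), with
`ε ∫ ∇v·∇φ + ∫ V f(v) f'(v) φ = ∫ f(v)^{2·2*−1} f'(v) φ` for all test functions `φ`,
where `f'(v) = 1/√(1 + f(v)²)`, and `u = f(v) → 0` as `|x| → ∞`. -/
theorem stmt_19 (N : ℕ) (hN : 2 < N) (twoStar : ℝ) (h2s : twoStar = 2 * N / (N - 2))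
    (f : ℝ → ℝ) (hf₁ : Function.LeftInverse f h) (hf₂ : Function.RightInverse f h)
    (R₁ r₁ r₂ R₂ α : ℝ) (hR₁ : 0 < R₁) (hr₁ : R₁ < r₁) (hr₂ : r₁ < r₂) (hR₂ : r₂ < R₂)
    (hα : 0 < α)
    (Ω Λ : Set (EuclideanSpace ℝ (Fin N)))
    (hΩ : Ω = {x : EuclideanSpace ℝ (Fin N) | r₁ < ‖x‖ ∧ ‖x‖ < r₂})
    (hΛ : Λ = {x : EuclideanSpace ℝ (Fin N) | R₁ < ‖x‖ ∧ ‖x‖ < R₂})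
    (V : EuclideanSpace ℝ (Fin N) → ℝ) (hVcont : Continuous V)
    (hVrad : ∀ x y : EuclideanSpace ℝ (Fin N), ‖x‖ = ‖y‖ → V x = V y)
    (hV₀ : ∀ x, 0 ≤ V x) (hVΩ : ∀ x ∈ Ω, V x = 0) (hVα : ∀ x, x ∉ Λ → α ≤ V x) :
    ∃ ε₀ : ℝ, 0 < ε₀ ∧ ∀ ε : ℝ, 0 < ε → ε < ε₀ →
      ∃ (v : EuclideanSpace ℝ (Fin N) → ℝ)
        (g : EuclideanSpace ℝ (Fin N) → EuclideanSpace ℝ (Fin N)),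
        (∀ x, 0 ≤ v x) ∧
        (∀ x y : EuclideanSpace ℝ (Fin N), ‖x‖ = ‖y‖ → v x = v y) ∧
        Continuous v ∧ v ≠ 0 ∧
        Integrable (fun x => ‖g x‖ ^ 2) ∧
        (∀ (φ : EuclideanSpace ℝ (Fin N) → ℝ), ContDiff ℝ (⊤ : ℕ∞) φ → HasCompactSupport φ →
          ∀ i : Fin N,
            ∫ x, v x * fderiv ℝ φ x (EuclideanSpace.single i 1)
              = -∫ x, g x i * φ x) ∧
        Integrable (fun x => V x * f (v x) ^ 2) ∧
        (∀ (φ : EuclideanSpace ℝ (Fin N) → ℝ), ContDiff ℝ (⊤ : ℕ∞) φ → HasCompactSupport φ →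
          ε * (∫ x, (inner ℝ (g x) (gradient φ x) : ℝ))
              + (∫ x, V x * f (v x) * (1 / Real.sqrt (1 + f (v x) ^ 2)) * φ x)
            = ∫ x, f (v x) ^ (2 * twoStar - 1)
                * (1 / Real.sqrt (1 + f (v x) ^ 2)) * φ x) ∧
        Tendsto (fun x => f (v x)) (cocompact (EuclideanSpace ℝ (Fin N))) (nhds 0) := by
  obtain ⟨n, hn⟩ : ∃ n, N = n + 1 := ⟨N - 1, by omega⟩
  have hN' : (2:ℝ) < N := by exact_mod_cast hN
  have h2s' : 2 ≤ twoStar := by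
    rw [h2s, le_div_iff₀ (by linarith)]
    linarith
  have hq : 1 ≤ 2 * twoStar - 2 := by linarith
  have hE : Nontrivial (EuclideanSpace ℝ (Fin N)) := by
    have : Nonempty (Fin N) := ⟨⟨0, by omega⟩⟩
    infer_instance
  have hdim : Module.finrank ℝ (EuclideanSpace ℝ (Fin N)) - 1 = n := by
    rw [finrank_euclideanSpace_fin]; omega
  obtain ⟨W, hWdef⟩ : ∃ W : ℝ → ℝ,
      W = fun t => V (t • EuclideanSpace.single (⟨0, by omega⟩ : Fin N) (1:ℝ)) := ⟨_, rfl⟩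
  have hnorm : ∀ t : ℝ, ‖t • EuclideanSpace.single (⟨0, by omega⟩ : Fin N) (1:ℝ)‖ = |t| := by
    intro t
    rw [norm_smul, EuclideanSpace.norm_single]
    simp
  have hVW : ∀ x, V x = W ‖x‖ := by
    intro x
    rw [hWdef]
    apply hVrad
    rw [hnorm, abs_of_nonneg (norm_nonneg x)]
  have hWc : Continuous W := by
    rw [hWdef]
    exact hVcont.comp (continuous_id.smul continuous_const)
  have hW0 : ∀ t, 0 ≤ W t := fun t => by rw [hWdef]; exact hV₀ _
  have hfc : Continuous f := by
    have : LipschitzWith 1 f := LipschitzWith.of_dist_le_mul fun x y => by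
      simpa [Real.dist_eq] using f_lip hf₂ x y
    exact this.continuous
  obtain ⟨ε₀, hε₀, hmain⟩ := radial (W := W) n (nl_f hf₁ hf₂ hq) hWc hW0
    (R₁ := R₁) (r₁ := (2 * r₁ + r₂) / 3) (r₂ := (r₁ + 2 * r₂) / 3) (R₂ := R₂) (α := α) hR₁
    (by linarith) (by linarith) (by linarith)
    (by
      rintro t ⟨ht1, ht2⟩
      rw [hWdef]
      apply hVΩ
      rw [hΩ, Set.mem_setOf_eq, hnorm, abs_of_nonneg (by linarith)]
      constructor <;> linarith) hα
    (by
      intro t ht0 ht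
      rw [hWdef]
      apply hVα
      rw [hΛ, Set.mem_setOf_eq, hnorm, abs_of_nonneg ht0]
      intro hcon
      linarith [hcon.1])
    (by
      intro t ht
      rw [hWdef]
      apply hVα
      rw [hΛ, Set.mem_setOf_eq, hnorm, abs_of_nonneg (by linarith)]
      intro hcon
      linarith [hcon.2])
  refine ⟨ε₀, hε₀, fun ε hε hlt => ?_⟩
  obtain ⟨a, v, g, ha, hvc, hgc, hv, hd, hvb, hlim, hi1, hi2⟩ := hmain ε hε hlt
  have hk : Continuous (kAvg n g) := kAvg_continuous n hgc
  refine ⟨fun x => v ‖x‖, fun x => kAvg n g ‖x‖ • x, fun x => (hvb _ (norm_nonneg x)).1,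
    fun x y hxy => by simp only [hxy], by fun_prop, ?_, ?_, ?_, ?_, ?_, ?_⟩
  · intro hcon
    have h0 := congrFun hcon 0
    simp only [norm_zero, Pi.zero_apply] at h0
    have h1 := hv 0 le_rfl
    rw [intervalIntegral.integral_same] at h1
    linarith
  · have := (integrable_fun_norm_addHaar (volume : Measure (EuclideanSpace ℝ (Fin N)))
      (f := fun r => (r * kAvg n g r) ^ 2)).2 (by rw [hdim]; exact hi1)
    refine this.congr (Eventually.of_forall fun x => ?_)
    simp only [norm_smul, Real.norm_eq_abs, mul_pow, sq_abs]
    ring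
  · intro φ hφ hc i
    have := weak_grad hvc hk hv hφ hc i
    rw [this]
    rfl
  · have := (integrable_fun_norm_addHaar (volume : Measure (EuclideanSpace ℝ (Fin N)))
      (f := fun r => W r * v r ^ 2)).2 (by rw [hdim]; exact hi2)
    refine this.mono' ?_ (Eventually.of_forall fun x => ?_)
    · exact (by fun_prop : Continuous fun x => V x * f (v ‖x‖) ^ 2).aestronglyMeasurable
    · have hv0 := (hvb _ (norm_nonneg x)).1
      rw [Real.norm_eq_abs, abs_of_nonneg (mul_nonneg (hV₀ x) (sq_nonneg _)), hVW x]
      exact mul_le_mul_of_nonneg_left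
        (pow_le_pow_left₀ (f_nonneg hf₁ hf₂ hv0) (f_le hf₁ hf₂ hv0) 2) (hW0 _)
  · intro φ hφ hc
    have h0 : kAvg n g 0 * (N : ℝ) = g 0 := by rw [hn]; exact kAvg_zero n g
    have hwd := weak_div hn hk hgc h0 hd hφ hc
    rw [hwd]
    have hsq : Continuous fun x : EuclideanSpace ℝ (Fin N) =>
        1 / Real.sqrt (1 + f (v ‖x‖) ^ 2) := by
      refine Continuous.div continuous_const (by fun_prop) fun x => ?_
      exact (Real.sqrt_pos.2 (by positivity)).ne'
    have hi3 : Integrable fun x : EuclideanSpace ℝ (Fin N) => g ‖x‖ * φ x :=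
      int_cs (by fun_prop) hφ.continuous hc
    have hi4 : Integrable fun x : EuclideanSpace ℝ (Fin N) =>
        V x * f (v ‖x‖) * (1 / Real.sqrt (1 + f (v ‖x‖) ^ 2)) * φ x :=
      int_cs (by fun_prop) hφ.continuous hc
    rw [mul_neg, ← integral_const_mul, neg_add_eq_sub, ← integral_sub hi4 (hi3.const_mul ε)]
    refine integral_congr_ae (Eventually.of_forall fun x => ?_)
    beta_reduce
    obtain ⟨hb0, hb1, hb2⟩ := hvb _ (norm_nonneg x)
    rw [hb2, SS_eq hf₁ hf₂ hb0 hb1, AA_eq hf₁ hf₂ hb0 hb1, hVW x]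
    have hp : f (v ‖x‖) ^ (2 * twoStar - 1) = f (v ‖x‖) ^ (2 * twoStar - 2) * f (v ‖x‖) := by
      rw [← Real.rpow_add_one' (f_nonneg hf₁ hf₂ hb0) (by linarith)]
      congr 1
      ring
    rw [hp]
    have hs : Real.sqrt (1 + f (v ‖x‖) ^ 2) ≠ 0 := (Real.sqrt_pos.2 (by positivity)).ne'
    field_simp
    ring
  · have h1 : Tendsto (fun x : EuclideanSpace ℝ (Fin N) => v ‖x‖)
        (cocompact (EuclideanSpace ℝ (Fin N))) (nhds 0) :=
      hlim.comp (tendsto_norm_cocompact_atTop (E := EuclideanSpace ℝ (Fin N)))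
    have h2 := (hfc.tendsto 0).comp h1
    rw [f_zero hf₁] at h2
    exact h2
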